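/- Let Ω be a bounded domain in ℝ^m with infinitely smooth boundary. Let B be a non-negative injective compact operator on L²(Ω) such that for every f ∈ L²(Ω) the function u = Bf satisfies -Δu = f in the distributional sense (so B is the inverse of a positive well-defined restriction L of the maximal operator generated by -Δ), and suppose lim_{n→∞} n^2 s_n(B) = ∞ and lim_{n→∞} n^α s_n(B) = a for some 0 < α < 2 and 0 < a < ∞. Let K be a bounded operator on L²(Ω) belonging to the Schatten class S_q for some 0 < q ≤ 1/α, whose range is contained in {u ∈ L²(Ω) : Δu = 0 in the distributional sense}. Then the operator B + K has a nonzero eigenvalue; hence the well-defined restriction L_K of the maximal operator, with L_K^{-1} = B + K, is not Volterra. -/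

import Mathlib

open Filter Topology MeasureTheory

/-- The `n`-th singular value (`s`-number) of an operator on a Hilbert space,
indexed so that `sNum T 1 = ‖T‖`: `sNum T n` is the distance from `T` to the
operators of rank `< n`. -/
noncomputable def sNum {H : Type*} [NormedAddCommGroup H] [InnerProductSpace ℂ H]
    (T : H →L[ℂ] H) (n : ℕ) : ℝ :=
  ⨅ F : {F : H →L[ℂ] H // Module.rank ℂ (LinearMap.range (F : H →ₗ[ℂ] H)) < (n : Cardinal)},
    ‖T - (F : H →L[ℂ] H)‖

/-- The Laplacian of a test function on `ℝ^m`, as the sum of the second partial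
derivatives in the coordinate directions. -/
noncomputable def testLaplacian {m : ℕ} (φ : EuclideanSpace ℝ (Fin m) → ℂ)
    (x : EuclideanSpace ℝ (Fin m)) : ℂ :=
  ∑ i : Fin m,
    iteratedFDeriv ℝ 2 φ x ![EuclideanSpace.single i 1, EuclideanSpace.single i 1]

/-- `u` is harmonic on `Ω` in the distributional sense: `∫ u Δφ = 0` for every smooth
compactly supported test function `φ` with support in `Ω`. -/
def WeakHarmonicOn {m : ℕ} (Ω : Set (EuclideanSpace ℝ (Fin m)))
    (u : EuclideanSpace ℝ (Fin m) → ℂ) : Prop :=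
  ∀ φ : EuclideanSpace ℝ (Fin m) → ℂ, ContDiff ℝ (⊤ : ℕ∞) φ → HasCompactSupport φ →
    tsupport φ ⊆ Ω → ∫ x in Ω, u x * testLaplacian φ x = 0

/-- `-Δu = f` on `Ω` in the distributional sense: `∫ u Δφ = -∫ f φ` for every smooth
compactly supported test function `φ` with support in `Ω`. -/
def WeakNegLapEq {m : ℕ} (Ω : Set (EuclideanSpace ℝ (Fin m)))
    (u f : EuclideanSpace ℝ (Fin m) → ℂ) : Prop :=
  ∀ φ : EuclideanSpace ℝ (Fin m) → ℂ, ContDiff ℝ (⊤ : ℕ∞) φ → HasCompactSupport φ →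
    tsupport φ ⊆ Ω → ∫ x in Ω, u x * testLaplacian φ x = -∫ x in Ω, f x * φ x

/-- `Ω` has infinitely smooth boundary: every boundary point admits a local smooth
defining function with nonvanishing derivative. -/
def HasSmoothBoundary {m : ℕ} (Ω : Set (EuclideanSpace ℝ (Fin m))) : Prop :=
  ∀ x ∈ frontier Ω, ∃ (U : Set (EuclideanSpace ℝ (Fin m)))
    (ψ : EuclideanSpace ℝ (Fin m) → ℝ), IsOpen U ∧ x ∈ U ∧ ContDiff ℝ (⊤ : ℕ∞) ψ ∧
      (∀ y ∈ U, fderiv ℝ ψ y ≠ 0) ∧ Ω ∩ U = {y ∈ U | ψ y < 0}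

set_option linter.unusedSimpArgs false
set_option linter.unusedSectionVars false

namespace BK
open Module

/-- `c n` bounds the distance of `T` to operators of rank at most `n`. -/
def Apx {E F : Type*} [NormedAddCommGroup E] [InnerProductSpace ℂ E]
    [NormedAddCommGroup F] [InnerProductSpace ℂ F] (T : E →L[ℂ] F) (c : ℕ → ℝ) : Prop :=
  ∀ n : ℕ, ∀ ε : ℝ, 0 < ε → ∃ G : E →L[ℂ] F,
    FiniteDimensional ℂ (LinearMap.range (G : E →ₗ[ℂ] F)) ∧
    finrank ℂ (LinearMap.range (G : E →ₗ[ℂ] F)) ≤ n ∧ ‖T - G‖ ≤ c n + ε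

section fd
variable {E : Type*} [NormedAddCommGroup E] [InnerProductSpace ℂ E] [FiniteDimensional ℂ E]

lemma apx_nonneg {F : Type*} [NormedAddCommGroup F] [InnerProductSpace ℂ F] {E : Type*}
    [NormedAddCommGroup E] [InnerProductSpace ℂ E] {T : E →L[ℂ] F} {c : ℕ → ℝ}
    (h : Apx T c) (n : ℕ) : 0 ≤ c n := by
  refine le_of_forall_pos_le_add fun ε hε => ?_
  obtain ⟨G, -, -, h3⟩ := h n ε hε
  exact (norm_nonneg _).trans h3

lemma exists_vec {N : ℕ} (hN : finrank ℂ E = N) (e : OrthonormalBasis (Fin N) ℂ E)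
    (G : E →ₗ[ℂ] E) (i : Fin N) (hG : finrank ℂ (LinearMap.range G) ≤ i) :
    ∃ v : E, v ≠ 0 ∧ G v = 0 ∧ ∀ k, i < k → inner ℂ (e k) v = 0 := by
  let L : E →ₗ[ℂ] (LinearMap.range G) × ({k : Fin N // i < k} → ℂ) :=
    LinearMap.prod G.rangeRestrict
      (LinearMap.pi fun k => ((innerSL ℂ (e k.1) : E →L[ℂ] ℂ) : E →ₗ[ℂ] ℂ))
  have hcard : Fintype.card {k : Fin N // i < k} = N - 1 - i := by
    rw [Fintype.card_subtype]
    have : (Finset.univ.filter fun k : Fin N => i < k) = Finset.Ioi i := by ext; simp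
    rw [this, Fin.card_Ioi]
  have hlt : finrank ℂ ((LinearMap.range G) × ({k : Fin N // i < k} → ℂ)) < finrank ℂ E := by
    rw [Module.finrank_prod, Module.finrank_pi, hcard, hN]
    have := i.2
    omega
  have hk := LinearMap.ker_ne_bot_of_finrank_lt (f := L) hlt
  obtain ⟨v, hv, hv0⟩ := Submodule.exists_mem_ne_zero_of_ne_bot hk
  have hv' : L v = 0 := hv
  have h1 : G.rangeRestrict v = 0 := congrArg Prod.fst hv'
  have h2 := congrArg Prod.snd hv'
  refine ⟨v, hv0, ?_, ?_⟩
  · have := congrArg Subtype.val h1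
    simpa using this
  · intro k hk
    have := congrFun h2 ⟨k, hk⟩
    simpa [L] using this

lemma eig_le {N : ℕ} (hN : finrank ℂ E = N) (T : E →L[ℂ] E) {c : ℕ → ℝ} (h : Apx T c)
    (i : Fin N) :
    (T : E →ₗ[ℂ] E).isSymmetric_adjoint_comp_self.eigenvalues hN i ≤ c i ^ 2 := by
  set hS := (T : E →ₗ[ℂ] E).isSymmetric_adjoint_comp_self
  set e := hS.eigenvectorBasis hN with he
  have key : ∀ ε : ℝ, 0 < ε → hS.eigenvalues hN i ≤ (c i + ε) ^ 2 := by
    intro ε hε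
    obtain ⟨G, -, hG, hTG⟩ := h i ε hε
    obtain ⟨v, hv0, hGv, hv⟩ := exists_vec hN e (G : E →ₗ[ℂ] E) i hG
    have hvpos : 0 < ‖v‖ ^ 2 := by positivity
    have hb : ‖T v‖ ≤ (c i + ε) * ‖v‖ := by
      have : T v = (T - G) v := by
        have : G v = 0 := hGv
        simp [this]
      rw [this]
      exact ((T - G).le_opNorm v).trans (by gcongr)
    have hexp : ‖T v‖ ^ 2 = ∑ k, hS.eigenvalues hN k * ‖inner ℂ (e k) v‖ ^ 2 := by
      have h1 : (inner ℂ v ((LinearMap.adjoint (T : E →ₗ[ℂ] E) ∘ₗ (T : E →ₗ[ℂ] E)) v) : ℂ)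
          = (‖T v‖ ^ 2 : ℝ) := by
        rw [LinearMap.comp_apply, LinearMap.adjoint_inner_right]
        simp [inner_self_eq_norm_sq_to_K]
      rw [← e.sum_inner_mul_inner] at h1
      have h2 : ∀ k, inner ℂ v (e k) * inner ℂ (e k)
          ((LinearMap.adjoint (T : E →ₗ[ℂ] E) ∘ₗ (T : E →ₗ[ℂ] E)) v)
          = ((hS.eigenvalues hN k * ‖inner ℂ (e k) v‖ ^ 2 : ℝ) : ℂ) := by
        intro k
        have := hS.eigenvectorBasis_apply_self_apply hN v k
        rw [OrthonormalBasis.repr_apply_apply, OrthonormalBasis.repr_apply_apply] at this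
        rw [he, this, ← inner_conj_symm v, ← he]
        have h3 := Complex.conj_mul' (inner ℂ (e k) v)
        push_cast
        rw [← h3]
        simp only [Complex.coe_algebraMap]
        ring
      rw [Finset.sum_congr rfl fun k _ => h2 k] at h1
      exact_mod_cast h1.symm
    have hlow : hS.eigenvalues hN i * ‖v‖ ^ 2 ≤ ‖T v‖ ^ 2 := by
      rw [hexp, ← e.sum_sq_norm_inner_right v, Finset.mul_sum]
      refine Finset.sum_le_sum fun k _ => ?_
      by_cases hk : i < k
      · simp [hv k hk]
      · gcongr
        exact hS.eigenvalues_antitone hN (not_lt.mp hk)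
    have : hS.eigenvalues hN i * ‖v‖ ^ 2 ≤ (c i + ε) ^ 2 * ‖v‖ ^ 2 := by
      refine hlow.trans ?_
      rw [← mul_pow]
      gcongr
    exact le_of_mul_le_mul_right this hvpos
  have hc : Tendsto (fun ε : ℝ => (c i + ε) ^ 2) (𝓝[>] 0) (𝓝 ((c i + 0) ^ 2)) :=
    (Continuous.tendsto (by fun_prop) 0).mono_left nhdsWithin_le_nhds
  rw [add_zero] at hc
  exact ge_of_tendsto hc (eventually_nhdsWithin_of_forall key)

lemma det_le {N : ℕ} (hN : finrank ℂ E = N) (T : E →L[ℂ] E) {c : ℕ → ℝ} (h : Apx T c) :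
    ‖LinearMap.det (T : E →ₗ[ℂ] E)‖ ≤ ∏ i ∈ Finset.range N, c i := by
  set hS := (T : E →ₗ[ℂ] E).isSymmetric_adjoint_comp_self
  have h1 := (T : E →ₗ[ℂ] E).normDet_sq
  rw [hS.det_eq_prod_eigenvalues hN, LinearMap.normDet_eq_norm_det] at h1
  have h2 : ‖LinearMap.det (T : E →ₗ[ℂ] E)‖ ^ 2 = ∏ i, hS.eigenvalues hN i := by
    exact_mod_cast h1
  rw [← Fin.prod_univ_eq_prod_range]
  have h3 : ‖LinearMap.det (T : E →ₗ[ℂ] E)‖ ^ 2 ≤ (∏ i : Fin N, c i) ^ 2 := by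
    rw [h2, ← Finset.prod_pow]
    refine Finset.prod_le_prod (fun i _ => ?_) fun i _ => eig_le hN T h i
    exact (T : E →ₗ[ℂ] E).isPositive_adjoint_comp_self.nonneg_eigenvalues hN i
  exact le_of_sq_le_sq h3 (Finset.prod_nonneg fun i _ => apx_nonneg h i)

lemma frob_le {N : ℕ} (hN : finrank ℂ E = N) (T : E →L[ℂ] E) {c : ℕ → ℝ} (h : Apx T c)
    (b : OrthonormalBasis (Fin N) ℂ E) :
    ∑ i, ‖T (b i)‖ ^ 2 ≤ ∑ i ∈ Finset.range N, c i ^ 2 := by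
  set hS := (T : E →ₗ[ℂ] E).isSymmetric_adjoint_comp_self
  have h1 := LinearMap.trace_eq_sum_inner
    (LinearMap.adjoint (T : E →ₗ[ℂ] E) ∘ₗ (T : E →ₗ[ℂ] E)) b
  rw [hS.trace_eq_sum_eigenvalues hN] at h1
  have h2 : ∀ i, (inner ℂ (b i) ((LinearMap.adjoint (T : E →ₗ[ℂ] E) ∘ₗ (T : E →ₗ[ℂ] E)) (b i)) : ℂ)
      = ((‖T (b i)‖ ^ 2 : ℝ) : ℂ) := by
    intro i
    rw [LinearMap.comp_apply, LinearMap.adjoint_inner_right]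
    simp [inner_self_eq_norm_sq_to_K]
  rw [Finset.sum_congr rfl fun k _ => h2 k] at h1
  have h3 : ∑ i, hS.eigenvalues hN i = ∑ i, ‖T (b i)‖ ^ 2 := by
    have h4 : ((∑ i, hS.eigenvalues hN i : ℝ) : ℂ) = ((∑ i, ‖T (b i)‖ ^ 2 : ℝ) : ℂ) := by
      rw [Complex.ofReal_sum (s := Finset.univ) (f := fun i => ‖T (b i)‖ ^ 2)]
      exact h1
    exact_mod_cast h4
  rw [← h3, ← Fin.sum_univ_eq_sum_range (fun i => c i ^ 2)]
  exact Finset.sum_le_sum fun i _ => eig_le hN T h i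

lemma schur : ∀ (N : ℕ) (E : Type _) [NormedAddCommGroup E] [InnerProductSpace ℂ E]
    [FiniteDimensional ℂ E], finrank ℂ E = N → ∀ T : E →ₗ[ℂ] E,
    ∃ b : OrthonormalBasis (Fin N) ℂ E, ∀ i j, j < i → inner ℂ (b i) (T (b j)) = 0 := by
  intro N
  induction N with
  | zero =>
    intro E _ _ _ hE T
    exact ⟨(stdOrthonormalBasis ℂ E).reindex (finCongr hE), fun i => i.elim0⟩
  | succ N ih =>
    intro E _ _ _ hE T
    have : Nontrivial E := Module.nontrivial_of_finrank_pos (R := ℂ) (by omega)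
    obtain ⟨μ, hμ⟩ := Module.End.exists_eigenvalue T
    obtain ⟨w, hw⟩ := hμ.exists_hasEigenvector
    have hw0 : w ≠ 0 := hw.2
    have hTw : T w = μ • w := hw.apply_eq_smul
    set v : E := ((‖w‖ : ℂ)⁻¹) • w with hv
    have hv1 : ‖v‖ = 1 := by
      rw [hv, norm_smul]
      simp [hw0]
    have hTv : T v = μ • v := by
      rw [hv, map_smul, hTw, smul_comm]
    have hv0 : v ≠ 0 := by intro h; rw [h] at hv1; simp at hv1
    let W : Submodule ℂ E := (Submodule.span ℂ {v})ᗮ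
    have : Fact (finrank ℂ E = N + 1) := ⟨hE⟩
    have hW : finrank ℂ W = N := Submodule.finrank_orthogonal_span_singleton hv0
    obtain ⟨c, hc⟩ := ih W hW
      ((W.orthogonalProjectionOnto : E →ₗ[ℂ] W) ∘ₗ T ∘ₗ W.subtype)
    have hvc : ∀ i, inner ℂ v (c i : E) = 0 := fun i =>
      Submodule.mem_orthogonal_singleton_iff_inner_right.mp (c i).2
    have hcv : ∀ i, inner ℂ (c i : E) v = 0 := fun i =>
      Submodule.mem_orthogonal_singleton_iff_inner_left.mp (c i).2
    have hon : Orthonormal ℂ (Fin.cons v (fun i => (c i : E)) : Fin (N + 1) → E) := by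
      rw [orthonormal_iff_ite]
      intro i j
      have hcc := orthonormal_iff_ite.mp c.orthonormal
      refine Fin.cases ?_ (fun i => ?_) i <;> refine Fin.cases ?_ (fun j => ?_) j
      · simp [inner_self_eq_norm_sq_to_K, hv1]
      · simp [hvc, (Fin.succ_ne_zero j).symm]
      · simp [hcv]
      · have := hcc i j
        rw [Submodule.coe_inner] at this
        simpa using this
    have hsp := hon.linearIndependent.span_eq_top_of_card_eq_finrank (by simp [hE])
    refine ⟨OrthonormalBasis.mk hon hsp.ge, ?_⟩
    intro i j hij
    simp only [OrthonormalBasis.coe_mk]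
    obtain ⟨i, rfl⟩ := Fin.exists_succ_eq.mpr (Fin.ne_zero_of_lt hij)
    refine Fin.cases (fun _ => ?_) (fun j hij => ?_) j hij
    · simp [hTv, inner_smul_right, hcv]
    · have := hc i j (Fin.succ_lt_succ_iff.mp hij)
      simp only [LinearMap.comp_apply, Submodule.subtype_apply] at this
      rw [Fin.cons_succ, Fin.cons_succ]
      rw [← this]
      exact (Submodule.inner_orthogonalProjectionOnto_eq_of_mem_left (c i) (T (c j : E))).symm

lemma schur_eig {N : ℕ} (hN : finrank ℂ E = N) (T : E →L[ℂ] E) {c : ℕ → ℝ} (h : Apx T c) :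
    ∃ μ : Fin N → ℂ, (∀ z : ℂ, LinearMap.det (1 - z • (T : E →ₗ[ℂ] E)) = ∏ i, (1 - z * μ i)) ∧
      LinearMap.trace ℂ E (T : E →ₗ[ℂ] E) = ∑ i, μ i ∧
      ∑ i, ‖μ i‖ ^ 2 ≤ ∑ i ∈ Finset.range N, c i ^ 2 ∧
      ∀ i, Module.End.HasEigenvalue (T : E →ₗ[ℂ] E) (μ i) := by
  obtain ⟨b, hb⟩ := schur N E hN (T : E →ₗ[ℂ] E)
  have hdet : ∀ S : E →ₗ[ℂ] E, (∀ i j, j < i → inner ℂ (b i) (S (b j)) = 0) →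
      LinearMap.det S = ∏ i, inner ℂ (b i) (S (b i)) := by
    intro S hS
    rw [← LinearMap.det_toMatrix b.toBasis, Matrix.det_of_isUpperTriangular]
    · refine Finset.prod_congr rfl fun i _ => ?_
      simp [LinearMap.toMatrix_apply, OrthonormalBasis.repr_apply_apply]
    · intro i j hij
      simpa [LinearMap.toMatrix_apply, OrthonormalBasis.repr_apply_apply] using hS i j hij
  have hbb := orthonormal_iff_ite.mp b.orthonormal
  refine ⟨fun i => inner ℂ (b i) (T (b i)), ?_, ?_, ?_, ?_⟩
  · intro z
    rw [hdet]
    · refine Finset.prod_congr rfl fun i _ => ?_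
      simp [inner_sub_right, inner_smul_right, hbb]
    · intro i j hij
      have := hb i j hij
      simp only [ContinuousLinearMap.coe_coe] at this
      simp [inner_sub_right, inner_smul_right, hbb, this, hij.ne']
  · rw [LinearMap.trace_eq_sum_inner _ b]; rfl
  · refine le_trans (Finset.sum_le_sum fun i _ => ?_) (frob_le hN T h b)
    have := norm_inner_le_norm (𝕜 := ℂ) (b i) (T (b i))
    rw [b.norm_eq_one, one_mul] at this
    gcongr
  · intro i
    rw [Module.End.hasEigenvalue_iff]
    have h0 : LinearMap.det ((T : E →ₗ[ℂ] E) - algebraMap ℂ (Module.End ℂ E)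
        (inner ℂ (b i) (T (b i)))) = 0 := by
      rw [hdet]
      · apply Finset.prod_eq_zero (Finset.mem_univ i)
        simp [inner_sub_right, inner_smul_right, hbb, Module.algebraMap_end_apply]
      · intro k j hij
        have := hb k j hij
        simp only [ContinuousLinearMap.coe_coe] at this
        simp [inner_sub_right, inner_smul_right, hbb, this, hij.ne', Module.algebraMap_end_apply]
    rw [Module.End.eigenspace_def]
    exact (LinearMap.bot_lt_ker_of_det_eq_zero h0).ne'

lemma apx_one_add {T : E →L[ℂ] E} {c : ℕ → ℝ} (h : Apx T c) :
    Apx (1 + T) (fun n => 1 + c n) := by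
  intro n ε hε
  obtain ⟨G, h1, h2, h3⟩ := h n ε hε
  refine ⟨G, h1, h2, ?_⟩
  have : (1 + T - G) = 1 + (T - G) := by abel
  rw [this]
  have h4 : ‖(1 : E →L[ℂ] E)‖ ≤ 1 := ContinuousLinearMap.norm_id_le
  linarith [norm_add_le (1 : E →L[ℂ] E) (T - G)]

end fd

section gen
variable {E F G H : Type*} [NormedAddCommGroup E] [InnerProductSpace ℂ E]
  [NormedAddCommGroup F] [InnerProductSpace ℂ F]
  [NormedAddCommGroup G] [InnerProductSpace ℂ G]
  [NormedAddCommGroup H] [InnerProductSpace ℂ H]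

lemma rank_comp (A : F →L[ℂ] G) (T : E →L[ℂ] F) (D : H →L[ℂ] E)
    [FiniteDimensional ℂ (LinearMap.range (T : E →ₗ[ℂ] F))] :
    FiniteDimensional ℂ (LinearMap.range ((A ∘L T ∘L D : H →L[ℂ] G) : H →ₗ[ℂ] G)) ∧
    finrank ℂ (LinearMap.range ((A ∘L T ∘L D : H →L[ℂ] G) : H →ₗ[ℂ] G)) ≤
      finrank ℂ (LinearMap.range (T : E →ₗ[ℂ] F)) := by
  have hle : LinearMap.range ((A ∘L T ∘L D : H →L[ℂ] G) : H →ₗ[ℂ] G) ≤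
      (LinearMap.range (T : E →ₗ[ℂ] F)).map (A : F →ₗ[ℂ] G) := by
    rintro _ ⟨x, rfl⟩
    exact ⟨T (D x), ⟨D x, rfl⟩, rfl⟩
  exact ⟨Submodule.finiteDimensional_of_le hle,
    (Submodule.finrank_mono hle).trans (Submodule.finrank_map_le _ _)⟩

lemma rank_add (S T : E →L[ℂ] F)
    [FiniteDimensional ℂ (LinearMap.range (S : E →ₗ[ℂ] F))]
    [FiniteDimensional ℂ (LinearMap.range (T : E →ₗ[ℂ] F))] :
    FiniteDimensional ℂ (LinearMap.range ((S + T : E →L[ℂ] F) : E →ₗ[ℂ] F)) ∧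
    finrank ℂ (LinearMap.range ((S + T : E →L[ℂ] F) : E →ₗ[ℂ] F)) ≤
      finrank ℂ (LinearMap.range (S : E →ₗ[ℂ] F)) +
      finrank ℂ (LinearMap.range (T : E →ₗ[ℂ] F)) := by
  have hle : LinearMap.range ((S + T : E →L[ℂ] F) : E →ₗ[ℂ] F) ≤
      LinearMap.range (S : E →ₗ[ℂ] F) ⊔ LinearMap.range (T : E →ₗ[ℂ] F) := by
    rintro _ ⟨x, rfl⟩
    exact Submodule.add_mem_sup ⟨x, rfl⟩ ⟨x, rfl⟩
  refine ⟨Submodule.finiteDimensional_of_le hle, (Submodule.finrank_mono hle).trans ?_⟩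
  exact Submodule.finrank_add_le_finrank_add_finrank _ _

lemma apx_comp {T : E →L[ℂ] F} {c : ℕ → ℝ} (h : Apx T c) (A : F →L[ℂ] G) (D : H →L[ℂ] E)
    {C : ℝ} (hC : ‖A‖ * ‖D‖ ≤ C) : Apx (A ∘L T ∘L D) (fun n => C * c n) := by
  intro n ε hε
  have hC0 : 0 ≤ C := le_trans (by positivity) hC
  obtain ⟨S, h1, h2, h3⟩ := h n (ε / (C + 1)) (by positivity)
  obtain ⟨h4, h5⟩ := rank_comp A S D
  refine ⟨A ∘L S ∘L D, h4, h5.trans h2, ?_⟩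
  have : A ∘L T ∘L D - A ∘L S ∘L D = A ∘L (T - S) ∘L D := by
    ext x; simp
  rw [this]
  calc ‖A ∘L (T - S) ∘L D‖ ≤ ‖A‖ * (‖T - S‖ * ‖D‖) :=
        (ContinuousLinearMap.opNorm_comp_le _ _).trans (by
          gcongr; exact ContinuousLinearMap.opNorm_comp_le _ _)
    _ = (‖A‖ * ‖D‖) * ‖T - S‖ := by ring
    _ ≤ C * (c n + ε / (C + 1)) := by gcongr
    _ ≤ C * c n + ε := by
      have : C * (ε / (C + 1)) ≤ ε := by
        rw [← mul_div_assoc, div_le_iff₀ (by positivity)]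
        nlinarith
      linarith

lemma apx_add {S T : E →L[ℂ] F} {c d : ℕ → ℝ} (hS : Apx S c) (hT : Apx T d) :
    Apx (S + T) (fun n => c (n / 2) + d (n / 2)) := by
  intro n ε hε
  obtain ⟨S', h1, h2, h3⟩ := hS (n / 2) (ε / 2) (by positivity)
  obtain ⟨T', k1, k2, k3⟩ := hT (n / 2) (ε / 2) (by positivity)
  obtain ⟨h4, h5⟩ := rank_add S' T'
  refine ⟨S' + T', h4, by omega, ?_⟩
  have : S + T - (S' + T') = (S - S') + (T - T') := by abel
  rw [this]
  linarith [norm_add_le (S - S') (T - T')]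

lemma apx_mul {S T : E →L[ℂ] E} {c d : ℕ → ℝ} (hS : Apx S c) (hT : Apx T d) :
    Apx (S * T) (fun n => c (n / 2) * d (n / 2)) := by
  intro n ε hε
  have hc := apx_nonneg hS (n / 2)
  have hd := apx_nonneg hT (n / 2)
  have hlim : Tendsto (fun δ : ℝ => (c (n / 2) + δ) * (d (n / 2) + δ)) (𝓝[>] 0)
      (𝓝 ((c (n / 2) + 0) * (d (n / 2) + 0))) :=
    (Continuous.tendsto (by fun_prop) 0).mono_left nhdsWithin_le_nhds
  simp only [add_zero] at hlim
  obtain ⟨δ, hδ, hδ0⟩ := ((hlim.eventually (gt_mem_nhds (lt_add_of_pos_right _ hε))).and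
    self_mem_nhdsWithin).exists
  obtain ⟨S', h1, h2, h3⟩ := hS (n / 2) δ hδ0
  obtain ⟨T', k1, k2, k3⟩ := hT (n / 2) δ hδ0
  have r1 := rank_comp (ContinuousLinearMap.id ℂ E) S' T
  have r2 := rank_comp (S - S') T' (ContinuousLinearMap.id ℂ E)
  have := r1.1
  have := r2.1
  obtain ⟨h4, h5⟩ := rank_add (ContinuousLinearMap.id ℂ E ∘L S' ∘L T)
    ((S - S') ∘L T' ∘L ContinuousLinearMap.id ℂ E)
  refine ⟨_, h4, ?_, ?_⟩
  · have := r1.2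
    have := r2.2
    omega
  · have : S * T - (ContinuousLinearMap.id ℂ E ∘L S' ∘L T +
        (S - S') ∘L T' ∘L ContinuousLinearMap.id ℂ E) = (S - S') * (T - T') := by
      ext x; simp; abel
    rw [this]
    refine le_trans (norm_mul_le _ _) (le_trans ?_ hδ.le)
    have : 0 ≤ c (n / 2) + δ := (norm_nonneg _).trans h3
    gcongr

lemma apx_sNum (T : E →L[ℂ] E) : Apx T (fun n => sNum T (n + 1)) := by
  intro n ε hε
  have : Nonempty {F : E →L[ℂ] E // Module.rank ℂ (LinearMap.range (F : E →ₗ[ℂ] E)) <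
      ((n + 1 : ℕ) : Cardinal)} := ⟨⟨0, by simp⟩⟩
  obtain ⟨⟨S, hS⟩, h⟩ := exists_lt_of_ciInf_lt (lt_add_of_pos_right (sNum T (n + 1)) hε)
  have hfin : Module.rank ℂ (LinearMap.range (S : E →ₗ[ℂ] E)) < Cardinal.aleph0 :=
    hS.trans (Cardinal.natCast_lt_aleph0)
  have hfd : FiniteDimensional ℂ (LinearMap.range (S : E →ₗ[ℂ] E)) :=
    Module.rank_lt_aleph0_iff.mp hfin
  refine ⟨S, hfd, ?_, h.le⟩
  rw [← Module.finrank_eq_rank] at hS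
  have : finrank ℂ (LinearMap.range (S : E →ₗ[ℂ] E)) < n + 1 := by exact_mod_cast hS
  omega

end gen

section fd2
variable {E : Type*} [NormedAddCommGroup E] [InnerProductSpace ℂ E] [FiniteDimensional ℂ E]

lemma trace_le {N : ℕ} (hN : finrank ℂ E = N) (T : E →L[ℂ] E) {c : ℕ → ℝ} (h : Apx T c) :
    ‖LinearMap.trace ℂ E (T : E →ₗ[ℂ] E)‖ ≤ ∑ i ∈ Finset.range N, c i := by
  set S := ∑ i ∈ Finset.range N, c i with hS
  set t := LinearMap.trace ℂ E (T : E →ₗ[ℂ] E) with ht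
  obtain ⟨μ, h1, h2, -, -⟩ := schur_eig hN T h
  -- the function `F z = det (1 - z T)` has derivative `- t` at `0`
  have hder : HasDerivAt (fun z : ℂ => LinearMap.det (1 - z • (T : E →ₗ[ℂ] E))) (-t) 0 := by
    have h3 : HasDerivAt (fun z : ℂ => ∏ i, (1 - z * μ i))
        (∑ i, (∏ j ∈ Finset.univ.erase i, (1 - (0 : ℂ) * μ j)) • (-(μ i))) 0 := by
      refine HasDerivAt.fun_finsetProd fun i _ => ?_
      have := ((hasDerivAt_id (0 : ℂ)).mul_const (μ i)).const_sub 1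
      simpa using this
    simp only [zero_mul, sub_zero, Finset.prod_const_one, one_smul, Finset.sum_neg_distrib] at h3
    rw [ht, h2]
    simpa only [h1] using h3
  have hbd : ∀ z : ℂ, ‖LinearMap.det (1 - z • (T : E →ₗ[ℂ] E))‖ ≤ Real.exp (‖z‖ * S) := by
    intro z
    have ha : Apx (1 + (-z) • T) (fun n => 1 + ‖z‖ * c n) := by
      apply apx_one_add
      have := apx_comp h ((-z) • ContinuousLinearMap.id ℂ E) (ContinuousLinearMap.id ℂ E)
        (C := ‖z‖) (by
          rw [norm_smul, norm_neg]
          have : ‖ContinuousLinearMap.id ℂ E‖ ≤ 1 := ContinuousLinearMap.norm_id_le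
          have h0 := norm_nonneg (ContinuousLinearMap.id ℂ E)
          have hz := norm_nonneg z
          nlinarith [mul_le_mul this this h0 zero_le_one])
      convert this using 1
      ext x
      simp
    have := det_le hN _ ha
    have he : ((1 + (-z) • T : E →L[ℂ] E) : E →ₗ[ℂ] E) = 1 - z • (T : E →ₗ[ℂ] E) := by
      ext x; simp [sub_eq_add_neg]
    rw [he] at this
    refine this.trans ?_
    rw [hS, Finset.mul_sum, Real.exp_sum]
    refine Finset.prod_le_prod (fun i _ => ?_) fun i _ => ?_
    · have := apx_nonneg h i
      positivity
    · linarith [Real.add_one_le_exp (‖z‖ * c i)]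
  by_contra hlt
  push Not at hlt
  have ht0 : t ≠ 0 := by
    intro h0
    rw [h0, norm_zero] at hlt
    exact absurd hlt (not_lt.mpr (Finset.sum_nonneg fun i _ => apx_nonneg h i))
  -- restrict to the ray on which `-t z` is positive
  set u : ℂ := -(starRingEnd ℂ t) / ‖t‖ with hu
  have hun : ‖u‖ = 1 := by
    rw [hu, norm_div, norm_neg, RCLike.norm_conj]
    simp [ht0]
  have hut : -t * u = ‖t‖ := by
    rw [hu]
    have : (‖t‖ : ℂ) ≠ 0 := by simpa using ht0
    field_simp
    rw [Complex.mul_conj']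
  have hder2 : HasDerivAt (fun x : ℝ => (LinearMap.det (1 - ((x : ℂ) * u) • (T : E →ₗ[ℂ] E))).re)
      ‖t‖ 0 := by
    have hl : HasDerivAt (fun z : ℂ => z * u) u ((0 : ℝ) : ℂ) := by
      simpa using (hasDerivAt_id ((0 : ℝ) : ℂ)).mul_const u
    have hd' : HasDerivAt (fun z : ℂ => LinearMap.det (1 - z • (T : E →ₗ[ℂ] E))) (-t)
        (((0 : ℝ) : ℂ) * u) := by simpa using hder
    have := (HasDerivAt.comp (h := fun z : ℂ => z * u)
      (h₂ := fun z : ℂ => LinearMap.det (1 - z • (T : E →ₗ[ℂ] E))) ((0 : ℝ) : ℂ) hd' hl).real_of_complex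
    rw [hut] at this
    simpa using this
  have hder3 : HasDerivAt (fun x : ℝ => Real.exp (x * S)) S 0 := by
    simpa using ((hasDerivAt_id (0 : ℝ)).mul_const S).exp
  have hder4 := hder3.sub hder2
  have hsl := hder4.tendsto_slope_zero_right
  have hneg : S - ‖t‖ < 0 := by linarith
  have hge : 0 ≤ S - ‖t‖ := by
    refine ge_of_tendsto hsl ?_
    filter_upwards [self_mem_nhdsWithin] with x hx
    have hx : 0 < x := hx
    have hb := (Complex.re_le_norm _).trans (hbd ((x : ℂ) * u))
    have hxn : ‖(x : ℂ) * u‖ = x := by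
      rw [norm_mul, hun, mul_one, Complex.norm_real, Real.norm_of_nonneg hx.le]
    rw [hxn] at hb
    simp only [zero_add, Pi.sub_apply, smul_eq_mul]
    have : (0 : ℝ) ≤ x⁻¹ := by positivity
    refine mul_nonneg this ?_
    have hz : (LinearMap.det (1 - (((0 : ℝ) : ℂ) * u) • (T : E →ₗ[ℂ] E))).re = 1 := by simp
    rw [hz]
    simp only [zero_mul, Real.exp_zero]
    linarith
  linarith

end fd2


end BK

namespace BK
open Module

set_option linter.unusedSectionVars false
section trunc
variable {H : Type*} [NormedAddCommGroup H] [InnerProductSpace ℂ H] [CompleteSpace H]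

/-- diagonal operator -/
noncomputable def dg {N : ℕ} (l : Fin N → ℂ) :
    EuclideanSpace ℂ (Fin N) →L[ℂ] EuclideanSpace ℂ (Fin N) :=
  Matrix.toEuclideanCLM (𝕜 := ℂ) (Matrix.diagonal l)

lemma dg_apply {N : ℕ} (l : Fin N → ℂ) (x : EuclideanSpace ℂ (Fin N)) (i : Fin N) :
    dg l x i = l i * x i := by
  simp [dg, Matrix.ofLp_toEuclideanCLM, Matrix.mulVec_diagonal]

lemma dg_norm {N : ℕ} (l : Fin N → ℂ) (C : ℝ) (hC : 0 ≤ C) (h : ∀ i, ‖l i‖ ≤ C) :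
    ‖dg l‖ ≤ C := by
  refine ContinuousLinearMap.opNorm_le_bound _ hC fun x => ?_
  refine le_of_sq_le_sq ?_ (by positivity)
  rw [mul_pow, EuclideanSpace.norm_sq_eq, EuclideanSpace.norm_sq_eq, Finset.mul_sum]
  refine Finset.sum_le_sum fun i _ => ?_
  rw [dg_apply, norm_mul, mul_pow]
  gcongr
  exact h i

lemma dg_det {N : ℕ} (l : Fin N → ℂ) :
    LinearMap.det ((dg l : _ →L[ℂ] _) : EuclideanSpace ℂ (Fin N) →ₗ[ℂ] _) = ∏ i, l i := by
  rw [← LinearMap.det_toMatrix (EuclideanSpace.basisFun (Fin N) ℂ).toBasis]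
  have : LinearMap.toMatrix (EuclideanSpace.basisFun (Fin N) ℂ).toBasis
    (EuclideanSpace.basisFun (Fin N) ℂ).toBasis
    ((dg l : _ →L[ℂ] _) : EuclideanSpace ℂ (Fin N) →ₗ[ℂ] _) = Matrix.diagonal l := by
    ext i j
    simp [LinearMap.toMatrix_apply, dg_apply, Matrix.diagonal_apply]
  rw [this, Matrix.det_diagonal]

lemma dg_trace {N : ℕ} (l : Fin N → ℂ) :
    LinearMap.trace ℂ _ ((dg l : _ →L[ℂ] _) : EuclideanSpace ℂ (Fin N) →ₗ[ℂ] _) = ∑ i, l i := by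
  rw [LinearMap.trace_eq_matrix_trace ℂ (EuclideanSpace.basisFun (Fin N) ℂ).toBasis]
  have : LinearMap.toMatrix (EuclideanSpace.basisFun (Fin N) ℂ).toBasis
    (EuclideanSpace.basisFun (Fin N) ℂ).toBasis
    ((dg l : _ →L[ℂ] _) : EuclideanSpace ℂ (Fin N) →ₗ[ℂ] _) = Matrix.diagonal l := by
    ext i j
    simp [LinearMap.toMatrix_apply, dg_apply, Matrix.diagonal_apply]
  rw [this, Matrix.trace_diagonal]

/-- the isometric embedding of the first `N` basis vectors -/
noncomputable def Jn (b : ℕ → H) (N : ℕ) : EuclideanSpace ℂ (Fin N) →L[ℂ] H :=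
  LinearMap.toContinuousLinearMap
    ((EuclideanSpace.basisFun (Fin N) ℂ).toBasis.constr ℂ (fun i : Fin N => b i))

lemma Jn_apply (b : ℕ → H) (N : ℕ) (x : EuclideanSpace ℂ (Fin N)) :
    Jn b N x = ∑ i : Fin N, x i • b i := by
  simp [Jn, Basis.constr_apply_fintype]

lemma Jn_inner {b : ℕ → H} (hb : Orthonormal ℂ b) (N : ℕ) (x y : EuclideanSpace ℂ (Fin N)) :
    inner ℂ (Jn b N x) (Jn b N y) = inner ℂ x y := by
  have hb' : Orthonormal ℂ (fun i : Fin N => b i) := hb.comp _ Fin.val_injective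
  rw [Jn_apply, Jn_apply, hb'.inner_sum]
  simp [PiLp.inner_apply, mul_comm]

lemma Jn_norm {b : ℕ → H} (hb : Orthonormal ℂ b) (N : ℕ) (x : EuclideanSpace ℂ (Fin N)) :
    ‖Jn b N x‖ = ‖x‖ := by
  rw [@norm_eq_sqrt_re_inner ℂ, Jn_inner hb, ← @norm_eq_sqrt_re_inner ℂ]

lemma Jn_le {b : ℕ → H} (hb : Orthonormal ℂ b) (N : ℕ) : ‖Jn b N‖ ≤ 1 :=
  ContinuousLinearMap.opNorm_le_bound _ zero_le_one fun x => by rw [Jn_norm hb, one_mul]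

lemma Jn_adj_le {b : ℕ → H} (hb : Orthonormal ℂ b) (N : ℕ) :
    ‖(Jn b N).adjoint‖ ≤ 1 := by
  rw [LinearIsometryEquiv.norm_map]; exact Jn_le hb N

lemma Jn_adj {b : ℕ → H} (hb : Orthonormal ℂ b) (N : ℕ) (x : EuclideanSpace ℂ (Fin N)) :
    (Jn b N).adjoint (Jn b N x) = x := by
  refine ext_inner_right ℂ fun y => ?_
  rw [ContinuousLinearMap.adjoint_inner_left, Jn_inner hb]

lemma Jn_adj_apply (b : ℕ → H) (N : ℕ) (w : H) (i : Fin N) :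
    (Jn b N).adjoint w i = inner ℂ (b i) w := by
  have : (Jn b N).adjoint w i = inner ℂ (EuclideanSpace.single i (1 : ℂ))
      ((Jn b N).adjoint w) := by
    rw [EuclideanSpace.inner_single_left]; simp
  rw [this, ContinuousLinearMap.adjoint_inner_right, Jn_apply]
  congr 1
  rw [Finset.sum_eq_single i]
  · simp
  · intro j _ hj; simp [hj]
  · simp

lemma proj_tendsto (b : HilbertBasis ℕ ℂ H) (w : H) :
    Tendsto (fun N => Jn b N ((Jn b N).adjoint w)) atTop (𝓝 w) := by
  have := (b.hasSum_repr w).tendsto_sum_nat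
  refine this.congr fun N => ?_
  rw [Jn_apply, Finset.sum_range]
  refine Finset.sum_congr rfl fun i _ => ?_
  rw [Jn_adj_apply, b.repr_apply_apply]

/-- truncation -/
noncomputable def tr (b : ℕ → H) (N : ℕ) (T : H →L[ℂ] H) :
    EuclideanSpace ℂ (Fin N) →L[ℂ] EuclideanSpace ℂ (Fin N) :=
  (Jn b N).adjoint ∘L T ∘L (Jn b N)

lemma apx_tr {b : ℕ → H} (hb : Orthonormal ℂ b) (N : ℕ) {T : H →L[ℂ] H} {c : ℕ → ℝ}
    (h : Apx T c) : Apx (tr b N T) c := by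
  have := apx_comp h (Jn b N).adjoint (Jn b N) (C := 1)
    (mul_le_one₀ (Jn_adj_le hb N) (norm_nonneg _) (Jn_le hb N))
  simp only [one_mul] at this
  exact this

lemma tr_diag {b : ℕ → H} (hb : Orthonormal ℂ b) (N : ℕ) {B : H →L[ℂ] H} {l : ℕ → ℝ}
    (hB : ∀ j, B (b j) = (l j : ℂ) • b j) :
    tr b N B = dg (fun i : Fin N => (l i : ℂ)) := by
  ext x i
  rw [tr, ContinuousLinearMap.comp_apply, ContinuousLinearMap.comp_apply]
  have : B (Jn b N x) = Jn b N (dg (fun i : Fin N => (l i : ℂ)) x) := by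
    rw [Jn_apply, Jn_apply, map_sum]
    refine Finset.sum_congr rfl fun i _ => ?_
    rw [map_smul, hB, dg_apply, smul_smul, mul_comm]
  rw [this, Jn_adj hb]

lemma eig_small (b : HilbertBasis ℕ ℂ H) {V : H →L[ℂ] H} (hV : IsCompactOperator V)
    (hne : ∀ μ : ℂ, μ ≠ 0 → ¬ Module.End.HasEigenvalue (V : H →ₗ[ℂ] H) μ) (ε : ℝ) (hε : 0 < ε) :
    ∀ᶠ N in atTop, ∀ μ : ℂ, Module.End.HasEigenvalue
      ((tr b N V : _ →L[ℂ] _) : EuclideanSpace ℂ (Fin N) →ₗ[ℂ] _) μ → ‖μ‖ < ε := by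
  by_contra hcon
  rw [not_eventually] at hcon
  obtain ⟨φ, hφ, h⟩ := extraction_of_frequently_atTop hcon
  push Not at h
  choose μ hμ hμε using h
  have h1 : ∀ k, ∃ y : EuclideanSpace ℂ (Fin (φ k)), ‖y‖ = 1 ∧ tr b (φ k) V y = μ k • y := by
    intro k
    obtain ⟨w, hw⟩ := (hμ k).exists_hasEigenvector
    have hw0 : w ≠ 0 := hw.2
    have hTw : tr b (φ k) V w = μ k • w := hw.apply_eq_smul
    refine ⟨((‖w‖ : ℂ)⁻¹) • w, ?_, ?_⟩
    · rw [norm_smul]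
      simp [hw0]
    · rw [map_smul, hTw, smul_comm]
  choose y hy1 hy2 using h1
  set x : ℕ → H := fun k => Jn b (φ k) (y k) with hx
  have hx1 : ∀ k, ‖x k‖ = 1 := fun k => by rw [hx]; simp [Jn_norm b.orthonormal, hy1]
  have hμ0 : ∀ k, μ k ≠ 0 := fun k h => by
    have := hμε k; rw [h, norm_zero] at this; linarith
  have hx2 : ∀ k, x k = (μ k)⁻¹ • Jn b (φ k) ((Jn b (φ k)).adjoint (V (x k))) := by
    intro k
    have h2 : (Jn b (φ k)).adjoint (V (x k)) = μ k • y k := hy2 k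
    rw [h2, map_smul, smul_smul, inv_mul_cancel₀ (hμ0 k), one_smul]
  obtain ⟨Q, hQ, hVQ⟩ := IsCompactOperator.image_closedBall_subset_compact
    (f := (V : H →ₗ[ℂ] H)) hV 1
  obtain ⟨w, -, ψ, hψ, hw⟩ := hQ.tendsto_subseq (x := fun k => V (x k))
    (fun k => hVQ ⟨x k, by simp [hx1], rfl⟩)
  obtain ⟨z, -, χ, hχ, hz⟩ := (isCompact_closedBall (0 : ℂ) ε⁻¹).tendsto_subseq
    (x := fun k => (μ (ψ k))⁻¹) (fun k => by
      rw [mem_closedBall_zero_iff, norm_inv]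
      exact inv_anti₀ hε (hμε _))
  set k' : ℕ → ℕ := fun k => ψ (χ k) with hk'
  have hk : Tendsto k' atTop atTop := hψ.tendsto_atTop.comp hχ.tendsto_atTop
  have hw' : Tendsto (fun k => V (x (k' k))) atTop (𝓝 w) := hw.comp hχ.tendsto_atTop
  have hP : Tendsto (fun k => Jn b (φ (k' k)) ((Jn b (φ (k' k))).adjoint (V (x (k' k)))))
      atTop (𝓝 w) := by
    have h3 := (proj_tendsto b w).comp (hφ.tendsto_atTop.comp hk)
    have h4 : Tendsto (fun k => Jn b (φ (k' k)) ((Jn b (φ (k' k))).adjoint (V (x (k' k)) - w)))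
        atTop (𝓝 0) := by
      refine squeeze_zero_norm (a := fun k => ‖V (x (k' k)) - w‖) (fun k => ?_) ?_
      · rw [Jn_norm b.orthonormal]
        exact (ContinuousLinearMap.le_of_opNorm_le _ (Jn_adj_le b.orthonormal _) _).trans
          (one_mul _).le
      · exact tendsto_iff_norm_sub_tendsto_zero.mp hw'
    have h5 := h4.add h3
    rw [zero_add] at h5
    refine h5.congr fun k => ?_
    simp
  have hxl : Tendsto (fun k => x (k' k)) atTop (𝓝 (z • w)) := by
    refine (hz.smul hP).congr fun k => ?_
    exact (hx2 _).symm
  have hn : ‖z • w‖ = 1 := by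
    refine tendsto_nhds_unique hxl.norm ?_
    simp [hx1]
  have hVw : V (z • w) = w := tendsto_nhds_unique ((V.continuous.tendsto _).comp hxl) hw'
  have hz0 : z ≠ 0 := by rintro rfl; simp at hn
  refine hne z⁻¹ (inv_ne_zero hz0) ?_
  refine Module.End.hasEigenvalue_of_hasEigenvector (x := z • w) ⟨?_, ?_⟩
  · rw [Module.End.mem_eigenspace_iff]
    change V (z • w) = _
    rw [hVw, smul_smul, inv_mul_cancel₀ hz0, one_smul]
  · intro h; rw [h] at hn; simp at hn

/-- The finite-dimensional data extracted from `V = B + K`. -/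
lemma trunc_data (b : HilbertBasis ℕ ℂ H) {B K : H →L[ℂ] H} {l c d : ℕ → ℝ}
    (hB : ∀ j, B (b j) = (l j : ℂ) • b j) (hV : IsCompactOperator (B + K))
    (hne : ∀ μ : ℂ, μ ≠ 0 → ¬ Module.End.HasEigenvalue ((B + K : H →L[ℂ] H) : H →ₗ[ℂ] H) μ)
    (hc : Apx (B + K) c) (hd : Apx K d) :
    ∃ μ : (N : ℕ) → Fin N → ℂ,
      (∀ ε : ℝ, 0 < ε → ∀ᶠ N in atTop, ∀ i, ‖μ N i‖ < ε) ∧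
      (∀ N, ∑ i, ‖μ N i‖ ^ 2 ≤ ∑ i ∈ Finset.range N, c i ^ 2) ∧
      (∀ N (z : ℂ), ‖∏ i, (1 - z * μ N i)‖ ≤ ∏ j ∈ Finset.range N, (1 + ‖z‖ * c j)) ∧
      (∀ N (z : ℂ) (C : ℝ), 0 ≤ C → (∀ j, 1 ≤ C * ‖1 - z * l j‖) → ‖∏ i, (1 - z * μ N i)‖ ≤
        (∏ j ∈ Finset.range N, ‖1 - z * l j‖) * ∏ j ∈ Finset.range N, (1 + C * ‖z‖ * d j)) ∧
      (∀ N, ‖∑ i, μ N i - ((∑ j ∈ Finset.range N, l j : ℝ) : ℂ)‖ ≤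
        ∑ j ∈ Finset.range N, d j) := by
  have hb := b.orthonormal
  have hfr : ∀ N, finrank ℂ (EuclideanSpace ℂ (Fin N)) = N := fun N => by simp
  have := fun N => schur_eig (hfr N) (tr b N (B + K)) (apx_tr hb N hc)
  choose μ h1 h2 h3 h4 using this
  have htr : ∀ N, tr b N (B + K) = dg (fun i : Fin N => (l i : ℂ)) + tr b N K := by
    intro N
    rw [← tr_diag hb N hB]
    ext x
    simp [tr]
  refine ⟨μ, ?_, h3, ?_, ?_, ?_⟩
  · intro ε hε
    filter_upwards [eig_small b hV hne ε hε] with N hN i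
    exact hN _ (h4 N i)
  · intro N z
    rw [← h1]
    have ha : Apx (1 + (-z) • tr b N (B + K)) (fun n => 1 + ‖z‖ * c n) := by
      apply apx_one_add
      have := apx_comp (apx_tr hb N hc) (dg (fun _ => -z)) (ContinuousLinearMap.id ℂ _)
        (C := ‖z‖) (by
          have h5 := dg_norm (fun _ : Fin N => -z) ‖z‖ (norm_nonneg _) (by simp)
          have h6 : ‖ContinuousLinearMap.id ℂ (EuclideanSpace ℂ (Fin N))‖ ≤ 1 :=
            ContinuousLinearMap.norm_id_le
          calc _ ≤ ‖z‖ * 1 := by gcongr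
            _ = _ := mul_one _)
      convert this using 1
      ext x i
      simp [dg_apply]
    have := det_le (hfr N) _ ha
    convert this using 3
    ext x
    simp [sub_eq_add_neg]
  · intro N z C hC hlb
    rw [← h1]
    have hn0 : ∀ j, 1 - z * (l j : ℂ) ≠ 0 := by
      intro j h0
      have := hlb j
      rw [h0] at this
      simp at this
      linarith
    have hfac : ((1 : EuclideanSpace ℂ (Fin N) →ₗ[ℂ] EuclideanSpace ℂ (Fin N)) -
        z • (tr b N (B + K) : EuclideanSpace ℂ (Fin N) →ₗ[ℂ] EuclideanSpace ℂ (Fin N))) =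
        (dg (fun i : Fin N => 1 - z * (l i : ℂ)) : EuclideanSpace ℂ (Fin N) →ₗ[ℂ] _) ∘ₗ
        ((1 + (dg (fun i : Fin N => -z * (1 - z * (l i : ℂ))⁻¹) ∘L tr b N K ∘L
          ContinuousLinearMap.id ℂ _) : EuclideanSpace ℂ (Fin N) →L[ℂ] _) :
            EuclideanSpace ℂ (Fin N) →ₗ[ℂ] _) := by
      ext x i
      have := hn0 i
      simp [htr, dg_apply]
      field_simp
      ring
    rw [hfac, LinearMap.det_comp, norm_mul, dg_det, norm_prod, Finset.prod_range]
    refine mul_le_mul_of_nonneg_left ?_ (Finset.prod_nonneg fun i _ => norm_nonneg _)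
    refine det_le (hfr N) _ (apx_one_add ?_)
    refine apx_comp (apx_tr hb N hd) _ _ ?_
    have h5 := dg_norm (fun i : Fin N => -z * (1 - z * (l i : ℂ))⁻¹) (C * ‖z‖) (by positivity) (by
      intro i
      rw [norm_mul, norm_neg, norm_inv, mul_comm]
      gcongr
      rw [inv_le_iff_one_le_mul₀ (norm_pos_iff.mpr (hn0 i))]
      exact hlb i)
    have h6 : ‖ContinuousLinearMap.id ℂ (EuclideanSpace ℂ (Fin N))‖ ≤ 1 :=
      ContinuousLinearMap.norm_id_le
    calc _ ≤ (C * ‖z‖) * 1 := by gcongr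
      _ = _ := mul_one _
  · intro N
    rw [← h2, htr]
    have : (((dg (fun i : Fin N => (l i : ℂ)) + tr b N K :
        EuclideanSpace ℂ (Fin N) →L[ℂ] EuclideanSpace ℂ (Fin N))) :
        EuclideanSpace ℂ (Fin N) →ₗ[ℂ] EuclideanSpace ℂ (Fin N)) =
        ((dg (fun i : Fin N => (l i : ℂ)) : EuclideanSpace ℂ (Fin N) →L[ℂ] _) :
        EuclideanSpace ℂ (Fin N) →ₗ[ℂ] EuclideanSpace ℂ (Fin N)) +
        ((tr b N K : EuclideanSpace ℂ (Fin N) →L[ℂ] _) :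
        EuclideanSpace ℂ (Fin N) →ₗ[ℂ] EuclideanSpace ℂ (Fin N)) := rfl
    rw [this, map_add, dg_trace, Finset.sum_range]
    push_cast
    rw [add_sub_cancel_left]
    exact trace_le (hfr N) _ (apx_tr hb N hd)

end trunc
end BK

namespace BK
open Module

lemma log_one_sub_est (w : ℂ) (hw : ‖w‖ ≤ 1 / 2) :
    ∃ R : ℂ, 1 - w = Complex.exp (-w - w ^ 2 / 2 + R) ∧ ‖R‖ ≤ ‖w‖ ^ 3 := by
  have h := Complex.norm_log_sub_logTaylor_le 2 (z := -w) (by rw [norm_neg]; linarith)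
  have hT : Complex.logTaylor (2 + 1) (-w) = -w - w ^ 2 / 2 := by
    simp [Complex.logTaylor_succ, Complex.logTaylor_zero]
    ring
  rw [hT, norm_neg] at h
  refine ⟨Complex.log (1 + -w) - (-w - w ^ 2 / 2), ?_, h.trans ?_⟩
  · rw [add_sub_cancel, Complex.exp_log]
    · ring
    · intro h0
      have : w = 1 := by linear_combination -h0
      rw [this] at hw
      norm_num at hw
  · have : (1 - ‖w‖)⁻¹ ≤ 2 := by
      rw [inv_le_comm₀ (by linarith) (by norm_num)]; linarith
    have h3 : 0 ≤ ‖w‖ ^ 3 := by positivity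
    norm_num
    nlinarith [mul_le_mul_of_nonneg_left this h3]

lemma cubic {N : ℕ} (μ : Fin N → ℂ) (z : ℂ) (m : ℝ) (hm : ∀ i, ‖μ i‖ ≤ m)
    (hzm : ‖z‖ * m ≤ 1 / 2) :
    ∃ R : ℂ, ∏ i, (1 - z * μ i) =
      Complex.exp (-z * ∑ i, μ i - z ^ 2 * (∑ i, μ i ^ 2) / 2 + R) ∧
      ‖R‖ ≤ ‖z‖ ^ 3 * m * ∑ i, ‖μ i‖ ^ 2 := by
  have h : ∀ i, ∃ R : ℂ, 1 - z * μ i = Complex.exp (-(z * μ i) - (z * μ i) ^ 2 / 2 + R) ∧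
      ‖R‖ ≤ ‖z * μ i‖ ^ 3 := by
    intro i
    apply log_one_sub_est
    rw [norm_mul]
    exact (mul_le_mul_of_nonneg_left (hm i) (norm_nonneg _)).trans hzm
  choose R h1 h2 using h
  refine ⟨∑ i, R i, ?_, ?_⟩
  · rw [Finset.prod_congr rfl fun i _ => h1 i, ← Complex.exp_sum]
    congr 1
    rw [Finset.sum_add_distrib, Finset.sum_sub_distrib, Finset.mul_sum, Finset.mul_sum,
      Finset.sum_div]
    congr 2
    · refine Finset.sum_congr rfl fun i _ => by ring
    · refine Finset.sum_congr rfl fun i _ => by ring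
  · refine (norm_sum_le _ _).trans ?_
    rw [Finset.mul_sum]
    refine Finset.sum_le_sum fun i _ => (h2 i).trans ?_
    rw [norm_mul, mul_pow]
    have : ‖μ i‖ ^ 3 ≤ m * ‖μ i‖ ^ 2 := by
      have := hm i
      have h0 : 0 ≤ ‖μ i‖ ^ 2 := by positivity
      nlinarith [mul_le_mul_of_nonneg_right this h0]
    calc _ ≤ ‖z‖ ^ 3 * (m * ‖μ i‖ ^ 2) := by gcongr
      _ = _ := by ring

/-- product bound coming from Euler's sine product -/
lemma euler_bound (R : ℝ) (hR : 1 ≤ R) (N : ℕ) :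
    ∏ j ∈ Finset.range N, (1 + (R / (j + 1)) ^ 2) ≤ Real.exp (Real.pi * R) := by
  have hpi := Real.pi_gt_three
  set P : ℕ → ℝ := fun n => ∏ j ∈ Finset.range n, (1 + (R / (j + 1)) ^ 2) with hP
  have hP0 : ∀ n, 0 ≤ P n := fun n => Finset.prod_nonneg fun j _ => by positivity
  have hmono : Monotone P := by
    refine monotone_nat_of_le_succ fun n => ?_
    simp only [hP]
    rw [Finset.prod_range_succ]
    refine le_mul_of_one_le_right (hP0 n) ?_
    have : 0 ≤ (R / ((n : ℝ) + 1)) ^ 2 := by positivity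
    linarith
  have h1 := (Complex.tendsto_euler_sin_prod (Complex.I * R)).norm
  have h2 : ∀ n : ℕ, ‖(Real.pi : ℂ) * (Complex.I * R) * ∏ j ∈ Finset.range n,
      ((1 : ℂ) - (Complex.I * R) ^ 2 / ((j : ℂ) + 1) ^ 2)‖ = Real.pi * R * P n := by
    intro n
    have : ∏ j ∈ Finset.range n, ((1 : ℂ) - (Complex.I * R) ^ 2 / ((j : ℂ) + 1) ^ 2) =
        ((P n : ℝ) : ℂ) := by
      rw [hP]
      push_cast
      refine Finset.prod_congr rfl fun j _ => ?_
      rw [mul_pow, Complex.I_sq, div_pow]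
      ring
    rw [this]
    simp only [norm_mul, Complex.norm_I, Complex.norm_real, one_mul]
    rw [Real.norm_of_nonneg (hP0 n), Real.norm_of_nonneg (by positivity),
      Real.norm_of_nonneg (by positivity)]
  simp only [h2] at h1
  have h3 : ‖Complex.sin (Real.pi * (Complex.I * R))‖ ≤ Real.exp (Real.pi * R) := by
    have he : Complex.sin (Real.pi * (Complex.I * R)) = ((Real.sinh (Real.pi * R) : ℝ) : ℂ) *
        Complex.I := by
      have : (Real.pi * (Complex.I * R) : ℂ) = ((Real.pi * R : ℝ) : ℂ) * Complex.I := by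
        push_cast; ring
      rw [this, Complex.sin_mul_I, Complex.ofReal_sinh]
    rw [he, norm_mul, Complex.norm_I, mul_one, Complex.norm_real, Real.norm_eq_abs, abs_le]
    rw [Real.sinh_eq]
    have ha := Real.exp_pos (Real.pi * R)
    have hb := Real.exp_pos (-(Real.pi * R))
    have hc : Real.exp (-(Real.pi * R)) ≤ Real.exp (Real.pi * R) :=
      Real.exp_le_exp.mpr (by nlinarith)
    constructor <;> linarith
  have h4 : Real.pi * R * P N ≤ ‖Complex.sin (Real.pi * (Complex.I * R))‖ := by
    refine ge_of_tendsto h1 ?_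
    filter_upwards [eventually_ge_atTop N] with n hn
    exact mul_le_mul_of_nonneg_left (hmono hn) (by positivity)
  have h5 : P N ≤ Real.pi * R * P N := le_mul_of_one_le_left (hP0 N) (by nlinarith)
  linarith

/-- The properties of the eigenvalues of truncations. -/
structure TData (l c d : ℕ → ℝ) (μ : (N : ℕ) → Fin N → ℂ) : Prop where
  small : ∀ ε : ℝ, 0 < ε → ∀ᶠ N in atTop, ∀ i, ‖μ N i‖ < ε
  sq : ∀ N, ∑ i, ‖μ N i‖ ^ 2 ≤ ∑ i ∈ Finset.range N, c i ^ 2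
  bd : ∀ N (z : ℂ), ‖∏ i, (1 - z * μ N i)‖ ≤ ∏ j ∈ Finset.range N, (1 + ‖z‖ * c j)
  fac : ∀ N (z : ℂ) (C : ℝ), 0 ≤ C → (∀ j, 1 ≤ C * ‖1 - z * l j‖) →
      ‖∏ i, (1 - z * μ N i)‖ ≤
        (∏ j ∈ Finset.range N, ‖1 - z * l j‖) * ∏ j ∈ Finset.range N, (1 + C * ‖z‖ * d j)
  trc : ∀ N, ‖∑ i, μ N i - ((∑ j ∈ Finset.range N, l j : ℝ) : ℂ)‖ ≤
        ∑ j ∈ Finset.range N, d j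

lemma prod_le_exp_tsum {d : ℕ → ℝ} (hd0 : ∀ j, 0 ≤ d j) (hd : Summable d) (r : ℝ) (hr : 0 ≤ r)
    (N : ℕ) : ∏ j ∈ Finset.range N, (1 + r * d j) ≤ Real.exp (r * ∑' j, d j) := by
  calc _ ≤ ∏ j ∈ Finset.range N, Real.exp (r * d j) :=
        Finset.prod_le_prod (fun i _ => by have := hd0 i; positivity)
          fun i _ => by linarith [Real.add_one_le_exp (r * d i)]
    _ = Real.exp (r * ∑ j ∈ Finset.range N, d j) := by rw [← Real.exp_sum, Finset.mul_sum]
    _ ≤ _ := by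
      gcongr
      exact hd.sum_le_tsum _ (fun i _ => hd0 i)

lemma stepD_aux {l c d : ℕ → ℝ} {μ : (N : ℕ) → Fin N → ℂ} (h : TData l c d μ)
    (hl0 : ∀ j, 0 ≤ l j) (A : ℝ) (hA : 1 ≤ A) (hlA : ∀ j, l j ≤ A / (j + 1))
    (hd0 : ∀ j, 0 ≤ d j) (hd : Summable d) (hc : Summable (fun j => c j ^ 2)) (M : ℕ)
    (r : ℝ) (hr : 1 ≤ r) :
    r * ∑ j ∈ Finset.range M, l j ≤ 4 * r * ∑' j, d j + 1 + Real.pi * (r * A) +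
      ∑ j ∈ Finset.range M, Real.log (1 + r * l j) := by
  have hr0 : 0 < r := by linarith
  set S := ∑' j, d j with hS
  have hS0 : 0 ≤ S := tsum_nonneg hd0
  set CF := ∑' j, c j ^ 2 with hCF
  have hCF0 : 0 ≤ CF := tsum_nonneg fun j => by positivity
  set m : ℝ := min (1 / (2 * r)) (1 / (2 * r ^ 3 * (CF + 1))) with hm
  have hm0 : 0 < m := by rw [hm]; positivity
  have hm1 : r * m ≤ 1 / 2 := by
    calc r * m ≤ r * (1 / (2 * r)) := by gcongr; exact min_le_left _ _
      _ = 1 / 2 := by field_simp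
  have hm2 : r ^ 3 * m * CF ≤ 1 / 2 := by
    calc r ^ 3 * m * CF ≤ r ^ 3 * (1 / (2 * r ^ 3 * (CF + 1))) * CF := by
          gcongr; exact min_le_right _ _
      _ = CF / (CF + 1) / 2 := by field_simp
      _ ≤ 1 / 2 := by
        have : CF / (CF + 1) ≤ 1 := by rw [div_le_one (by positivity)]; linarith
        linarith
  obtain ⟨N, hN, hNM⟩ := ((h.small m hm0).and (eventually_ge_atTop M)).exists
  have hn1 : ‖(-(r : ℂ))‖ = r := by
    rw [norm_neg, Complex.norm_real, Real.norm_of_nonneg hr0.le]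
  have hn2 : ‖(-(r : ℂ) * Complex.I)‖ = r := by
    rw [norm_mul, hn1, Complex.norm_I, mul_one]
  obtain ⟨R1, he1, hR1⟩ := cubic (μ N) (-(r : ℂ)) m (fun i => (hN i).le) (by rw [hn1]; exact hm1)
  obtain ⟨R2, he2, hR2⟩ := cubic (μ N) (-(r : ℂ) * Complex.I) m (fun i => (hN i).le)
    (by rw [hn2]; exact hm1)
  have hsq : ∑ i, ‖μ N i‖ ^ 2 ≤ CF :=
    (h.sq N).trans (hc.sum_le_tsum _ fun i _ => by positivity)
  have hRb : ∀ x : ℝ, x ≤ r ^ 3 * m * ∑ i, ‖μ N i‖ ^ 2 → x ≤ 1 / 2 := fun x hx =>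
    hx.trans (le_trans (by gcongr) hm2)
  rw [hn1] at hR1
  rw [hn2] at hR2
  have hR1' := hRb _ hR1
  have hR2' := hRb _ hR2
  set t := ∑ i, μ N i with ht
  -- lower bound
  have hlow : Real.exp (r * ∑ j ∈ Finset.range N, l j - 2 * r * S - 1) ≤
      ‖∏ i, (1 - (-(r : ℂ)) * μ N i)‖ * ‖∏ i, (1 - (-(r : ℂ) * Complex.I) * μ N i)‖ := by
    rw [← norm_mul, he1, he2, ← Complex.exp_add, Complex.norm_exp]
    apply Real.exp_le_exp.mpr
    have e : (-(-(r : ℂ)) * t - (-(r : ℂ)) ^ 2 * (∑ i, μ N i ^ 2) / 2 + R1 +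
        (-(-(r : ℂ) * Complex.I) * t - (-(r : ℂ) * Complex.I) ^ 2 * (∑ i, μ N i ^ 2) / 2 + R2)) =
        (r : ℂ) * ((1 + Complex.I) * t) + R1 + R2 := by
      rw [mul_pow, Complex.I_sq]; ring
    rw [e, Complex.add_re, Complex.add_re, Complex.re_ofReal_mul]
    have h1 := (abs_le.mp ((Complex.abs_re_le_norm R1).trans hR1')).1
    have h2 := (abs_le.mp ((Complex.abs_re_le_norm R2).trans hR2')).1
    have h3 : ∑ j ∈ Finset.range N, l j - 2 * S ≤ ((1 + Complex.I) * t).re := by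
      have h4 := (h.trc N).trans (hd.sum_le_tsum _ fun i _ => hd0 i)
      set σ := ∑ j ∈ Finset.range N, l j
      have h5 : ((1 + Complex.I) * t).re = σ + (t - σ).re - (t - σ).im := by
        simp
      rw [h5]
      have h6 := (abs_le.mp ((Complex.abs_re_le_norm (t - σ)).trans h4)).1
      have h7 := (abs_le.mp ((Complex.abs_im_le_norm (t - σ)).trans h4)).2
      linarith
    nlinarith [mul_le_mul_of_nonneg_left h3 hr0.le]
  -- upper bounds
  have hf1 : ∀ j, 1 - (-(r : ℂ)) * (l j : ℂ) = ((1 + r * l j : ℝ) : ℂ) := fun j => by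
    push_cast; ring
  have hf1' : ∀ j, ‖1 - (-(r : ℂ)) * (l j : ℂ)‖ = 1 + r * l j := fun j => by
    rw [hf1, Complex.norm_real, Real.norm_of_nonneg]
    have := hl0 j; positivity
  have hf2' : ∀ j, ‖1 - (-(r : ℂ) * Complex.I) * (l j : ℂ)‖ = √(1 + (r * l j) ^ 2) := fun j => by
    have : 1 - (-(r : ℂ) * Complex.I) * (l j : ℂ) = ((1 : ℝ) : ℂ) + ((r * l j : ℝ) : ℂ) *
      Complex.I := by push_cast; ring
    rw [this, Complex.norm_add_mul_I]
    norm_num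
  have hu1 := h.fac N (-(r : ℂ)) 1 zero_le_one (fun j => by
    rw [hf1', one_mul]; have := mul_nonneg hr0.le (hl0 j); linarith)
  have hu2 := h.fac N (-(r : ℂ) * Complex.I) 1 zero_le_one (fun j => by
    rw [hf2', one_mul]; apply Real.one_le_sqrt.mpr; nlinarith [sq_nonneg (r * l j)])
  simp only [hf1', hn1, one_mul] at hu1
  simp only [hf2', hn2, one_mul] at hu2
  have hpd := prod_le_exp_tsum hd0 hd r hr0.le N
  have hp1 : 0 ≤ ∏ j ∈ Finset.range N, (1 + r * l j) :=
    Finset.prod_nonneg fun j _ => by have := hl0 j; positivity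
  have hp2 : ∏ j ∈ Finset.range N, √(1 + (r * l j) ^ 2) ≤ Real.exp (Real.pi * (r * A)) := by
    refine le_trans ?_ (euler_bound (r * A) (by nlinarith) N)
    refine Finset.prod_le_prod (fun i _ => Real.sqrt_nonneg _) fun j _ => ?_
    have h1 : √(1 + (r * l j) ^ 2) ≤ 1 + (r * l j) ^ 2 := by
      rw [Real.sqrt_le_left (by positivity)]
      nlinarith [sq_nonneg (r * l j)]
    refine h1.trans ?_
    have h2 := hlA j
    have h3 := hl0 j
    have : r * l j ≤ r * A / (j + 1) := by
      rw [mul_div_assoc]; gcongr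
    gcongr
  have hup : ‖∏ i, (1 - (-(r : ℂ)) * μ N i)‖ * ‖∏ i, (1 - (-(r : ℂ) * Complex.I) * μ N i)‖ ≤
      Real.exp (∑ j ∈ Finset.range N, Real.log (1 + r * l j) + r * S +
        (Real.pi * (r * A) + r * S)) := by
    rw [Real.exp_add, Real.exp_add, Real.exp_add, Real.exp_sum]
    have hexp : ∏ j ∈ Finset.range N, Real.exp (Real.log (1 + r * l j)) =
        ∏ j ∈ Finset.range N, (1 + r * l j) := by
      refine Finset.prod_congr rfl fun j _ => Real.exp_log ?_
      have := mul_nonneg hr0.le (hl0 j); linarith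
    rw [hexp]
    have hpd0 : 0 ≤ ∏ j ∈ Finset.range N, (1 + r * d j) :=
      Finset.prod_nonneg fun j _ => by have := hd0 j; positivity
    gcongr
    · exact hu1.trans (by gcongr)
    · exact hu2.trans (by gcongr)
  have hfin := Real.exp_le_exp.mp (hlow.trans hup)
  -- drop the terms beyond `M`
  have hsplit : ∑ j ∈ Finset.range M, (r * l j - Real.log (1 + r * l j)) ≤
      ∑ j ∈ Finset.range N, (r * l j - Real.log (1 + r * l j)) := by
    refine Finset.sum_le_sum_of_subset_of_nonneg (Finset.range_mono hNM) fun j _ _ => ?_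
    have h1 := mul_nonneg hr0.le (hl0 j)
    have := Real.log_le_sub_one_of_pos (x := 1 + r * l j) (by linarith)
    linarith
  rw [Finset.sum_sub_distrib, Finset.sum_sub_distrib, ← Finset.mul_sum, ← Finset.mul_sum]
    at hsplit
  linarith

lemma stepD {l c d : ℕ → ℝ} {μ : (N : ℕ) → Fin N → ℂ} (h : TData l c d μ)
    (hl0 : ∀ j, 0 ≤ l j) (A : ℝ) (hA : 1 ≤ A) (hlA : ∀ j, l j ≤ A / (j + 1))
    (hd0 : ∀ j, 0 ≤ d j) (hd : Summable d) (hc : Summable (fun j => c j ^ 2)) :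
    Summable l := by
  refine summable_of_sum_range_le (c := 4 * ∑' j, d j + 1 + Real.pi * A + 1) hl0 fun M => ?_
  set σ := ∑ j ∈ Finset.range M, √(l j) with hσ
  have hσ0 : 0 ≤ σ := Finset.sum_nonneg fun j _ => Real.sqrt_nonneg _
  set x : ℝ := 2 * σ + 1 with hx
  have hx1 : 1 ≤ x := by linarith
  have hr : 1 ≤ x ^ 2 := by nlinarith
  have key := stepD_aux h hl0 A hA hlA hd0 hd hc M (x ^ 2) hr
  have hlog : ∑ j ∈ Finset.range M, Real.log (1 + x ^ 2 * l j) ≤ 2 * x * σ := by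
    rw [hσ, Finset.mul_sum]
    refine Finset.sum_le_sum fun j _ => ?_
    set y := √(l j) with hy
    have hy0 : 0 ≤ y := Real.sqrt_nonneg _
    have hyl : l j = y ^ 2 := (Real.sq_sqrt (hl0 j)).symm
    rw [hyl]
    have hxy : 0 ≤ x * y := by positivity
    calc Real.log (1 + x ^ 2 * y ^ 2) ≤ Real.log ((1 + x * y) ^ 2) := by
          apply Real.log_le_log (by positivity); nlinarith
      _ = 2 * Real.log (1 + x * y) := by rw [Real.log_pow]; norm_num
      _ ≤ 2 * x * y := by
        have := Real.log_le_sub_one_of_pos (x := 1 + x * y) (by linarith)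
        linarith
  have h1 : 2 * x * σ ≤ x ^ 2 := by nlinarith
  have h2 : x ^ 2 * ∑ j ∈ Finset.range M, l j ≤
      x ^ 2 * (4 * ∑' j, d j + 1 + Real.pi * A + 1) := by nlinarith
  exact le_of_mul_le_mul_left h2 (by positivity)

end BK

namespace BK
open Module

lemma log_le_sqrt (x : ℝ) (hx : 0 ≤ x) : Real.log (1 + x) ≤ 2 * √x := by
  set y := √x with hy
  have hy0 : 0 ≤ y := Real.sqrt_nonneg _
  have hyl : x = y ^ 2 := (Real.sq_sqrt hx).symm
  rw [hyl]
  calc Real.log (1 + y ^ 2) ≤ Real.log ((1 + y) ^ 2) := by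
        apply Real.log_le_log (by positivity); nlinarith
    _ = 2 * Real.log (1 + y) := by rw [Real.log_pow]; norm_num
    _ ≤ 2 * y := by
      have := Real.log_le_sub_one_of_pos (x := 1 + y) (by linarith)
      linarith

/-- minimal exponential type -/
lemma small_type {c : ℕ → ℝ} (hc0 : ∀ j, 0 ≤ c j) (hc : Summable c) (ε : ℝ) (hε : 0 < ε) :
    ∃ R0 : ℝ, 1 ≤ R0 ∧ ∀ R, R0 ≤ R → ∀ N, ∏ j ∈ Finset.range N, (1 + R * c j) ≤
      Real.exp (ε * R) := by
  have ht := tendsto_sum_nat_add c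
  obtain ⟨M, hM⟩ := (ht.eventually (gt_mem_nhds (half_pos hε))).exists
  set σ := ∑ j ∈ Finset.range M, √(c j) with hσ
  have hσ0 : 0 ≤ σ := Finset.sum_nonneg fun j _ => Real.sqrt_nonneg _
  refine ⟨max 1 ((4 * σ / ε) ^ 2), le_max_left _ _, fun R hR N => ?_⟩
  have hR1 : 1 ≤ R := (le_max_left _ _).trans hR
  have hR0 : 0 ≤ R := by linarith
  have hR2 : (4 * σ / ε) ^ 2 ≤ R := (le_max_right _ _).trans hR
  have hf : ∀ j, 1 ≤ 1 + R * c j := fun j => by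
    have := mul_nonneg hR0 (hc0 j); linarith
  have h1 : ∏ j ∈ Finset.range N, (1 + R * c j) ≤ ∏ j ∈ Finset.range (N + M), (1 + R * c j) := by
    rw [Finset.prod_range_add]
    refine le_mul_of_one_le_right (Finset.prod_nonneg fun j _ => by linarith [hf j]) ?_
    have := Finset.prod_le_prod (s := Finset.range M) (f := fun _ => (1 : ℝ))
      (g := fun j => 1 + R * c (N + j)) (fun _ _ => zero_le_one) fun j _ => hf _
    rwa [Finset.prod_const_one] at this
  refine h1.trans ?_
  rw [add_comm N M, Finset.prod_range_add]
  have h2 : ∏ j ∈ Finset.range M, (1 + R * c j) ≤ Real.exp (2 * √R * σ) := by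
    rw [hσ, Finset.mul_sum, Real.exp_sum]
    refine Finset.prod_le_prod (fun j _ => by linarith [hf j]) fun j _ => ?_
    rw [← Real.log_le_iff_le_exp (by linarith [hf j])]
    refine (log_le_sqrt _ (mul_nonneg hR0 (hc0 j))).trans ?_
    rw [Real.sqrt_mul hR0]
    linarith
  have h3 : ∏ j ∈ Finset.range N, (1 + R * c (M + j)) ≤ Real.exp (R * (ε / 2)) := by
    refine (prod_le_exp_tsum (d := fun j => c (M + j)) (fun j => hc0 _) ?_ R hR0 N).trans ?_
    · simpa only [add_comm] using (summable_nat_add_iff M).mpr hc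
    · gcongr
      simpa only [add_comm] using hM.le
  have h4 : 2 * √R * σ ≤ R * (ε / 2) := by
    have h5 : 4 * σ / ε ≤ √R := Real.le_sqrt_of_sq_le hR2
    rw [div_le_iff₀ hε] at h5
    have h6 : √R * √R = R := Real.mul_self_sqrt hR0
    nlinarith [Real.sqrt_nonneg R]
  calc _ ≤ Real.exp (2 * √R * σ) * Real.exp (R * (ε / 2)) := by
        gcongr
        exact Finset.prod_nonneg fun j _ => by linarith [hf (M + j)]
    _ = Real.exp (2 * √R * σ + R * (ε / 2)) := (Real.exp_add _ _).symm
    _ ≤ _ := by gcongr; linarith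

lemma exists_unit_mul (t : ℂ) : ∃ u : ℂ, ‖u‖ = 1 ∧ u * t = ‖t‖ := by
  by_cases ht : t = 0
  · exact ⟨1, by simp, by simp [ht]⟩
  · refine ⟨(starRingEnd ℂ t) / ‖t‖, ?_, ?_⟩
    · rw [norm_div, RCLike.norm_conj]
      simp [ht]
    · have : (‖t‖ : ℂ) ≠ 0 := by simpa using ht
      field_simp
      rw [mul_comm, Complex.mul_conj']

section low
variable {l c d : ℕ → ℝ} {μ : (N : ℕ) → Fin N → ℂ}

/-- uniform version of `cubic` -/
lemma cubic_unif (h : TData l c d μ) (hc2 : Summable (fun j => c j ^ 2)) (R : ℝ) (hR : 1 ≤ R)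
    (η : ℝ) (hη : 0 < η) : ∀ᶠ N in atTop, ∀ w : ℂ, ‖w‖ ≤ R → ∃ E : ℂ,
      ∏ i, (1 - w * μ N i) =
      Complex.exp (-w * ∑ i, μ N i - w ^ 2 * (∑ i, μ N i ^ 2) / 2 + E) ∧ ‖E‖ ≤ η := by
  set CF := ∑' j, c j ^ 2 with hCF
  have hCF0 : 0 ≤ CF := tsum_nonneg fun j => by positivity
  have hR0 : 0 < R := by linarith
  set m : ℝ := min (1 / (2 * R)) (η / (R ^ 3 * (CF + 1))) with hm
  have hm0 : 0 < m := by rw [hm]; positivity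
  have hm1 : R * m ≤ 1 / 2 := by
    calc R * m ≤ R * (1 / (2 * R)) := by gcongr; exact min_le_left _ _
      _ = 1 / 2 := by field_simp
  have hm2 : R ^ 3 * m * CF ≤ η := by
    calc R ^ 3 * m * CF ≤ R ^ 3 * (η / (R ^ 3 * (CF + 1))) * CF := by
          gcongr; exact min_le_right _ _
      _ = η * (CF / (CF + 1)) := by field_simp
      _ ≤ η * 1 := by
        gcongr
        rw [div_le_one (by positivity)]; linarith
      _ = η := mul_one _
  filter_upwards [h.small m hm0] with N hN w hw
  obtain ⟨E, he, hE⟩ := cubic (μ N) w m (fun i => (hN i).le)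
    (le_trans (by gcongr) hm1)
  refine ⟨E, he, hE.trans (le_trans ?_ hm2)⟩
  have hsq : ∑ i, ‖μ N i‖ ^ 2 ≤ CF :=
    (h.sq N).trans (hc2.sum_le_tsum _ fun i _ => by positivity)
  gcongr

lemma tq_small (h : TData l c d μ) (hc0 : ∀ j, 0 ≤ c j) (hc : Summable c)
    (hc2 : Summable (fun j => c j ^ 2)) (ε : ℝ) (hε : 0 < ε) :
    ∀ᶠ N in atTop, ‖∑ i, μ N i‖ ≤ 4 * ε ∧ ‖∑ i, μ N i ^ 2‖ ≤ 4 * ε := by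
  obtain ⟨R0, hR01, hR0⟩ := small_type hc0 hc ε hε
  set R := max R0 (1 / ε) with hR
  have hRge : R0 ≤ R := le_max_left _ _
  have hR1 : 1 ≤ R := hR01.trans hRge
  have hRpos : 0 < R := by linarith
  have hRε : 1 ≤ ε * R := by
    have : 1 / ε ≤ R := le_max_right _ _
    rw [div_le_iff₀ hε] at this
    linarith
  filter_upwards [cubic_unif h hc2 R hR1 1 one_pos] with N hN
  set t := ∑ i, μ N i with ht
  set q := ∑ i, μ N i ^ 2 with hq
  have key : ∀ w : ℂ, ‖w‖ = R → (-w * t - w ^ 2 * q / 2).re ≤ ε * R + 1 := by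
    intro w hw
    obtain ⟨E, he, hE⟩ := hN w hw.le
    have h1 := h.bd N w
    rw [he, hw, Complex.norm_exp] at h1
    have h2 := Real.exp_le_exp.mp (h1.trans (hR0 R hRge N))
    rw [Complex.add_re] at h2
    have h3 := (abs_le.mp ((Complex.abs_re_le_norm E).trans hE)).1
    linarith
  have hq' : ‖q‖ * R ^ 2 / 2 ≤ ε * R + 1 := by
    obtain ⟨u, hu1, hu2⟩ := exists_unit_mul (-q)
    obtain ⟨v, hv⟩ : ∃ v : ℂ, v ^ 2 = u := IsAlgClosed.exists_pow_nat_eq u (by norm_num)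
    have hv1 : ‖v‖ = 1 := by
      have : ‖v‖ ^ 2 = 1 := by rw [← norm_pow, hv, hu1]
      nlinarith [norm_nonneg v]
    have hw : ‖(R : ℂ) * v‖ = R := by
      rw [norm_mul, hv1, mul_one, Complex.norm_real, Real.norm_of_nonneg hRpos.le]
    have h1 := key _ hw
    have h2 := key (-((R : ℂ) * v)) (by rw [norm_neg, hw])
    have e : (R * v : ℂ) ^ 2 * q / 2 = ((-(‖q‖ * R ^ 2 / 2) : ℝ) : ℂ) := by
      rw [mul_pow, hv]
      rw [norm_neg] at hu2
      push_cast
      linear_combination (-(R : ℂ) ^ 2 / 2) * hu2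
    rw [neg_sq] at h2
    rw [e] at h1 h2
    simp only [Complex.sub_re, Complex.ofReal_re, neg_mul, Complex.neg_re, neg_neg] at h1 h2
    linarith
  have ht' : ‖t‖ * R ≤ 2 * (ε * R + 1) := by
    obtain ⟨u, hu1, hu2⟩ := exists_unit_mul (-t)
    have hw : ‖(R : ℂ) * u‖ = R := by
      rw [norm_mul, hu1, mul_one, Complex.norm_real, Real.norm_of_nonneg hRpos.le]
    have h1 := key _ hw
    rw [norm_neg] at hu2
    have e : -(R * u : ℂ) * t = ((R * ‖t‖ : ℝ) : ℂ) := by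
      push_cast
      linear_combination (R : ℂ) * hu2
    rw [e, Complex.sub_re, Complex.ofReal_re] at h1
    have h2 : (((R : ℂ) * u) ^ 2 * q / 2).re ≤ ‖q‖ * R ^ 2 / 2 := by
      refine (Complex.re_le_norm _).trans (le_of_eq ?_)
      rw [norm_div, norm_mul, norm_pow, hw]
      norm_num
      ring
    linarith
  constructor
  · have : ‖t‖ * R ≤ 4 * ε * R := by linarith
    exact le_of_mul_le_mul_right this hRpos
  · have : ‖q‖ * R ^ 2 ≤ 4 * ε * R ^ 2 := by
      have : ε * R ≤ ε * R ^ 2 := by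
        have : R ≤ R ^ 2 := by nlinarith
        gcongr
      linarith
    exact le_of_mul_le_mul_right this (by positivity)

lemma low_bound (h : TData l c d μ) (hc0 : ∀ j, 0 ≤ c j) (hc : Summable c) (z : ℂ)
    (η : ℝ) (hη : 0 < η) :
    ∀ᶠ N in atTop, Real.exp (-η) ≤ ‖∏ i, (1 - z * μ N i)‖ := by
  have hc2 : Summable (fun j => c j ^ 2) := by
    have hb := hc.tendsto_atTop_zero.eventually (gt_mem_nhds one_pos)
    refine Summable.of_norm_bounded_eventually_nat (g := c) hc ?_
    filter_upwards [hb] with j hj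
    rw [Real.norm_of_nonneg (by positivity)]
    nlinarith [hc0 j]
  set R := ‖z‖ + 1 with hR
  have hR1 : 1 ≤ R := by have := norm_nonneg z; linarith
  set ε := η / (12 * R ^ 2) with hε
  have hε0 : 0 < ε := by positivity
  filter_upwards [cubic_unif h hc2 R hR1 (η / 3) (by positivity),
    tq_small h hc0 hc hc2 ε hε0] with N h1 h2
  obtain ⟨E, he, hE⟩ := h1 z (by linarith)
  rw [he, Complex.norm_exp]
  apply Real.exp_le_exp.mpr
  set t := ∑ i, μ N i with ht
  set q := ∑ i, μ N i ^ 2 with hq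
  have hn : ‖-z * t - z ^ 2 * q / 2 + E‖ ≤ η := by
    have hz : ‖z‖ ≤ R := by linarith
    have e1 : ‖-z * t‖ ≤ R ^ 2 * (4 * ε) := by
      rw [norm_mul, norm_neg]
      have : R ≤ R ^ 2 := by nlinarith
      exact mul_le_mul (hz.trans this) h2.1 (norm_nonneg _) (by positivity)
    have e2 : ‖z ^ 2 * q / 2‖ ≤ R ^ 2 * (4 * ε) := by
      rw [norm_div, norm_mul, norm_pow]
      have : ‖z‖ ^ 2 * ‖q‖ ≤ R ^ 2 * (4 * ε) :=
        mul_le_mul (by gcongr) h2.2 (norm_nonneg _) (by positivity)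
      have h0 : 0 ≤ ‖z‖ ^ 2 * ‖q‖ := by positivity
      norm_num
      linarith
    have e3 : R ^ 2 * (4 * ε) = η / 3 := by rw [hε]; field_simp; norm_num
    calc _ ≤ ‖-z * t‖ + ‖z ^ 2 * q / 2‖ + ‖E‖ :=
          (norm_add_le _ _).trans (by gcongr; exact norm_sub_le _ _)
      _ ≤ η / 3 + η / 3 + η / 3 := by rw [e3] at e1 e2; gcongr
      _ = η := by ring
  exact (abs_le.mp ((Complex.abs_re_le_norm _).trans hn)).1

end low
end BK

namespace BK
open Module

/-- partial sums of `-log (1 - x)` -/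
noncomputable def PN (N : ℕ) (x : ℝ) : ℝ := ∑ n ∈ Finset.range N, x ^ (n + 1) / ((n : ℝ) + 1)

/-- upper approximation of `log |1 - t|` -/
noncomputable def hN (N : ℕ) (t : ℝ) : ℝ := Real.log (max t 1) - PN N (min t t⁻¹)

lemma PN_nonneg (N : ℕ) {x : ℝ} (hx : 0 ≤ x) : 0 ≤ PN N x :=
  Finset.sum_nonneg fun n _ => by positivity

lemma PN_le (N : ℕ) {x : ℝ} (hx : 0 ≤ x) (hx1 : x ≤ 1) : PN N x ≤ N * x := by
  calc PN N x ≤ ∑ n ∈ Finset.range N, x := by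
        refine Finset.sum_le_sum fun n _ => ?_
        rw [div_le_iff₀ (by positivity)]
        have h1 : x ^ (n + 1) ≤ x := by
          rw [pow_succ]
          exact mul_le_of_le_one_left hx (pow_le_one₀ hx hx1)
        have h2 : (0 : ℝ) ≤ n := by positivity
        nlinarith
    _ = N * x := by simp

lemma PN_le_log (N : ℕ) {x : ℝ} (hx : 0 ≤ x) (hx1 : x < 1) : PN N x ≤ -Real.log (1 - x) := by
  have h := Real.hasSum_pow_div_log_of_abs_lt_one (x := x) (by rw [abs_of_nonneg hx]; exact hx1)
  exact sum_le_hasSum _ (fun n _ => by positivity) h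

lemma min_inv_nonneg {t : ℝ} (ht : 0 ≤ t) : 0 ≤ min t t⁻¹ := le_min ht (inv_nonneg.mpr ht)

lemma min_inv_le {t : ℝ} (_ht : 0 ≤ t) : min t t⁻¹ ≤ 1 := by
  rcases le_total t 1 with h | h
  · exact (min_le_left _ _).trans h
  · exact (min_le_right _ _).trans (inv_le_one_of_one_le₀ h)

lemma min_inv_le_log {t : ℝ} (ht : 0 ≤ t) : min t t⁻¹ ≤ 2 * Real.log (1 + t) := by
  have h1 : t / (1 + t) ≤ Real.log (1 + t) := by
    have := Real.one_sub_inv_le_log_of_pos (x := 1 + t) (by linarith)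
    have e : 1 - (1 + t)⁻¹ = t / (1 + t) := by field_simp; ring
    linarith
  rcases le_total t 1 with h | h
  · have : t / 2 ≤ t / (1 + t) := by gcongr; linarith
    linarith [min_le_left t t⁻¹]
  · have : 1 / 2 ≤ t / (1 + t) := by
      rw [div_le_div_iff₀ (by norm_num) (by linarith)]; linarith
    linarith [min_inv_le ht]

lemma hN_le (N : ℕ) {t : ℝ} (ht : 0 ≤ t) : hN N t ≤ Real.log (1 + t) := by
  have h1 := PN_nonneg N (min_inv_nonneg ht)
  have h2 : Real.log (max t 1) ≤ Real.log (1 + t) :=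
    Real.log_le_log (by positivity) (max_le (by linarith) (by linarith))
  unfold hN
  linarith

lemma le_hN (N : ℕ) {t : ℝ} (ht : 0 ≤ t) : -((1 + 2 * N) * Real.log (1 + t)) ≤ hN N t := by
  have h1 := PN_le N (min_inv_nonneg ht) (min_inv_le ht)
  have h2 := min_inv_le_log ht
  have h3 : 0 ≤ Real.log (max t 1) := Real.log_nonneg (le_max_right _ _)
  have h4 : 0 ≤ Real.log (1 + t) := Real.log_nonneg (by linarith)
  have h5 : (N : ℝ) * min t t⁻¹ ≤ N * (2 * Real.log (1 + t)) := by gcongr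
  unfold hN
  linarith

lemma log_le_hN (N : ℕ) {t : ℝ} (ht : 0 < t) (ht1 : t ≠ 1) : Real.log |1 - t| ≤ hN N t := by
  unfold hN
  rcases lt_or_gt_of_ne ht1 with h | h
  · have h1 : t ≤ t⁻¹ := h.le.trans (by rw [one_le_inv₀ ht]; exact h.le)
    rw [max_eq_right h.le, min_eq_left h1, abs_of_pos (by linarith), Real.log_one]
    linarith [PN_le_log N ht.le h]
  · have h0 : t⁻¹ < 1 := inv_lt_one_of_one_lt₀ h
    rw [max_eq_left h.le, min_eq_right (h0.trans h).le, abs_of_neg (by linarith)]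
    have e : -(1 - t) = t * (1 - t⁻¹) := by field_simp; ring
    rw [e, Real.log_mul ht.ne' (by linarith)]
    linarith [PN_le_log N (inv_nonneg.mpr ht.le) h0]

lemma hN_cont (N : ℕ) {t : ℝ} (ht : 0 < t) : ContinuousAt (hN N) t := by
  unfold hN PN
  refine ContinuousAt.sub ?_ ?_
  · refine ContinuousAt.log (by fun_prop) (by positivity)
  · refine tendsto_finsetSum _ fun n _ => ?_
    refine Tendsto.div_const (Tendsto.pow ?_ _) _
    exact (continuousAt_id).min (continuousAt_inv₀ ht.ne')

lemma hN_meas (N : ℕ) : Measurable (hN N) := by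
  unfold hN PN
  fun_prop

lemma integ_log (β A : ℝ) (hβ : 1 < β) (hA : 0 ≤ A) :
    IntegrableOn (fun y : ℝ => Real.log (1 + A * y ^ (-β))) (Set.Ioi 0) := by
  have hmeas : Measurable (fun y : ℝ => Real.log (1 + A * y ^ (-β))) := by fun_prop
  rw [← Set.Ioc_union_Ioi_eq_Ioi (zero_le_one (α := ℝ))]
  refine IntegrableOn.union ?_ ?_
  · have hi : IntegrableOn (fun y : ℝ => Real.log (1 + A) - β * Real.log y) (Set.Ioc 0 1) := by
      have h1 : IntervalIntegrable Real.log volume 0 1 := intervalIntegral.intervalIntegrable_log'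
      have h2 := (intervalIntegrable_iff_integrableOn_Ioc_of_le zero_le_one).mp h1
      refine Integrable.sub ?_ (h2.const_mul β)
      exact integrable_const _
    refine Integrable.mono' hi hmeas.aestronglyMeasurable ?_
    filter_upwards [ae_restrict_mem measurableSet_Ioc] with y hy
    have hy0 : 0 < y := hy.1
    have h1 : 1 ≤ y ^ (-β) := Real.one_le_rpow_of_pos_of_le_one_of_nonpos hy0 hy.2 (by linarith)
    have h0 : 0 ≤ A * y ^ (-β) := by positivity
    rw [Real.norm_of_nonneg (Real.log_nonneg (by linarith))]
    have e : Real.log (1 + A) - β * Real.log y = Real.log ((1 + A) * y ^ (-β)) := by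
      rw [Real.log_mul (by positivity) (by positivity), Real.log_rpow hy0]; ring
    rw [e]
    exact Real.log_le_log (by positivity) (by linarith)
  · have hi : IntegrableOn (fun y : ℝ => A * y ^ (-β)) (Set.Ioi 1) :=
      (integrableOn_Ioi_rpow_of_lt (by linarith) one_pos).const_mul A
    refine Integrable.mono' hi hmeas.aestronglyMeasurable ?_
    filter_upwards [ae_restrict_mem measurableSet_Ioi] with y hy
    have hy0 : 0 < y := zero_lt_one.trans hy
    have h0 : 0 ≤ A * y ^ (-β) := by positivity
    rw [Real.norm_of_nonneg (Real.log_nonneg (by linarith))]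
    have := Real.log_le_sub_one_of_pos (x := 1 + A * y ^ (-β)) (by linarith)
    linarith

lemma hN_integrable (β : ℝ) (hβ : 1 < β) (N : ℕ) :
    IntegrableOn (fun y : ℝ => hN N (y ^ (-β))) (Set.Ioi 0) := by
  have hi := (integ_log β 1 hβ zero_le_one).const_mul ((1 : ℝ) + 2 * N)
  refine Integrable.mono' hi
    ((hN_meas N).comp (by fun_prop : Measurable fun y : ℝ => y ^ (-β))).aestronglyMeasurable ?_
  filter_upwards [ae_restrict_mem measurableSet_Ioi] with y hy
  have hy0 : 0 < y := hy
  have h0 : 0 ≤ y ^ (-β) := by positivity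
  have h1 := le_hN N h0
  have h2 := hN_le N h0
  have h4 : 0 ≤ Real.log (1 + y ^ (-β)) := Real.log_nonneg (by linarith)
  have h5 : 0 ≤ (2 * N) * Real.log (1 + y ^ (-β)) := by positivity
  rw [one_mul, Real.norm_eq_abs, abs_le]
  constructor <;> linarith

lemma hN_integral (β : ℝ) (hβ : 1 < β) (N : ℕ) :
    ∫ y in Set.Ioi (0 : ℝ), hN N (y ^ (-β)) =
      β - ∑ n ∈ Finset.range N, 2 * β / (β ^ 2 * ((n : ℝ) + 1) ^ 2 - 1) := by
  have hi := hN_integrable β hβ N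
  rw [← Set.Ioc_union_Ioi_eq_Ioi (zero_le_one (α := ℝ))] at hi ⊢
  rw [setIntegral_union (Set.Ioc_disjoint_Ioi le_rfl) measurableSet_Ioi
    hi.left_of_union hi.right_of_union]
  have hpos : ∀ n : ℕ, 1 < β * ((n : ℝ) + 1) := fun n => by
    have : (0 : ℝ) ≤ n := by positivity
    nlinarith
  have e1 : ∫ y in Set.Ioc (0 : ℝ) 1, hN N (y ^ (-β)) =
      β - ∑ n ∈ Finset.range N, 1 / (β * ((n : ℝ) + 1) + 1) / ((n : ℝ) + 1) := by
    have h1 : ∫ y in Set.Ioc (0 : ℝ) 1, hN N (y ^ (-β)) =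
        ∫ y in Set.Ioc (0 : ℝ) 1, (-β * Real.log y -
          ∑ n ∈ Finset.range N, y ^ (β * ((n : ℝ) + 1)) / ((n : ℝ) + 1)) := by
      refine setIntegral_congr_fun measurableSet_Ioc fun y hy => ?_
      have hy0 : 0 < y := hy.1
      have h1 : 1 ≤ y ^ (-β) :=
        Real.one_le_rpow_of_pos_of_le_one_of_nonpos hy0 hy.2 (by linarith)
      have h2 : (y ^ (-β))⁻¹ = y ^ β := by rw [Real.rpow_neg hy0.le, inv_inv]
      have h3 : (y ^ (-β))⁻¹ ≤ y ^ (-β) := (inv_le_one_of_one_le₀ h1).trans h1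
      simp only [hN, PN]
      rw [max_eq_left h1, min_eq_right h3, h2, Real.log_rpow hy0]
      congr 1
      refine Finset.sum_congr rfl fun n _ => ?_
      rw [Real.rpow_mul hy0.le]
      norm_cast
    rw [h1, ← intervalIntegral.integral_of_le zero_le_one, intervalIntegral.integral_sub,
      intervalIntegral.integral_finsetSum]
    · rw [intervalIntegral.integral_const_mul, integral_log]
      simp only [Real.log_one, Real.log_zero]
      congr 1
      · ring
      · refine Finset.sum_congr rfl fun n _ => ?_
        rw [intervalIntegral.integral_div, integral_rpow (Or.inl (by linarith [hpos n]))]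
        rw [Real.one_rpow, Real.zero_rpow (by linarith [hpos n]), sub_zero]
    · intro n _
      exact (intervalIntegral.intervalIntegrable_rpow' (by linarith [hpos n])).div_const _
    · exact intervalIntegral.intervalIntegrable_log'.const_mul _
    · have e : (fun y : ℝ => ∑ n ∈ Finset.range N, y ^ (β * ((n : ℝ) + 1)) / ((n : ℝ) + 1)) =
          ∑ n ∈ Finset.range N, (fun y : ℝ => y ^ (β * ((n : ℝ) + 1)) / ((n : ℝ) + 1)) := by
        ext y
        simp
      rw [e]
      refine IntervalIntegrable.sum (ε := ℝ) _ fun n _ => ?_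
      exact (intervalIntegral.intervalIntegrable_rpow' (by linarith [hpos n])).div_const _
  have e2 : ∫ y in Set.Ioi (1 : ℝ), hN N (y ^ (-β)) =
      - ∑ n ∈ Finset.range N, 1 / (β * ((n : ℝ) + 1) - 1) / ((n : ℝ) + 1) := by
    have h1 : ∫ y in Set.Ioi (1 : ℝ), hN N (y ^ (-β)) =
        ∫ y in Set.Ioi (1 : ℝ), (-
          ∑ n ∈ Finset.range N, y ^ (-(β * ((n : ℝ) + 1))) / ((n : ℝ) + 1)) := by
      refine setIntegral_congr_fun measurableSet_Ioi fun y hy => ?_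
      have hy1 : 1 < y := hy
      have hy0 : 0 < y := zero_lt_one.trans hy
      have h1 : y ^ (-β) ≤ 1 := Real.rpow_le_one_of_one_le_of_nonpos hy1.le (by linarith)
      have h3 : y ^ (-β) ≤ (y ^ (-β))⁻¹ := h1.trans (by
        rw [one_le_inv₀ (by positivity)]; exact h1)
      simp only [hN, PN]
      rw [max_eq_right h1, min_eq_left h3, Real.log_one, zero_sub]
      congr 1
      refine Finset.sum_congr rfl fun n _ => ?_
      rw [← neg_mul, Real.rpow_mul hy0.le]
      norm_cast
    rw [h1, integral_neg, integral_finsetSum]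
    · congr 1
      refine Finset.sum_congr rfl fun n _ => ?_
      rw [integral_div, integral_Ioi_rpow_of_lt (by linarith [hpos n]) one_pos, Real.one_rpow]
      congr 1
      have h2 : -(β * ((n : ℝ) + 1)) + 1 ≠ 0 := by linarith [hpos n]
      have h3 : (β * ((n : ℝ) + 1)) - 1 ≠ 0 := by linarith [hpos n]
      rw [div_eq_div_iff h2 h3]
      ring
    · intro n _
      exact (integrableOn_Ioi_rpow_of_lt (by linarith [hpos n]) one_pos).div_const _
  rw [e1, e2, sub_add, sub_neg_eq_add, ← Finset.sum_add_distrib]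
  congr 1
  refine Finset.sum_congr rfl fun n _ => ?_
  have h2 : β * ((n : ℝ) + 1) + 1 ≠ 0 := by linarith [hpos n]
  have h3 : β * ((n : ℝ) + 1) - 1 ≠ 0 := by linarith [hpos n]
  have h4 : β ^ 2 * ((n : ℝ) + 1) ^ 2 - 1 = (β * ((n : ℝ) + 1) - 1) * (β * ((n : ℝ) + 1) + 1) := by
    ring
  have h5 : (n : ℝ) + 1 ≠ 0 := by positivity
  rw [h4]
  field_simp
  ring

lemma exists_neg (β : ℝ) (hβ : 1 < β) (hβ2 : β < 2) :
    ∃ N : ℕ, β - ∑ n ∈ Finset.range N, 2 * β / (β ^ 2 * ((n : ℝ) + 1) ^ 2 - 1) < 0 := by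
  have htel : ∀ N : ℕ, ∑ n ∈ Finset.range N, 2 / (4 * ((n : ℝ) + 1) ^ 2 - 1) =
      1 - 1 / (2 * (N : ℝ) + 1) := by
    intro N
    induction N with
    | zero => simp
    | succ N ih =>
      rw [Finset.sum_range_succ, ih]
      have : (4 * ((N : ℝ) + 1) ^ 2 - 1) = (2 * N + 1) * (2 * (N + 1) + 1) := by ring
      rw [this]
      push_cast
      field_simp
      ring
  set δ := 2 / (β ^ 2 - 1) - 2 / 3 with hδ
  have hb : 0 < β ^ 2 - 1 := by nlinarith
  have hδ0 : 0 < δ := by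
    have : 2 / 3 < 2 / (β ^ 2 - 1) := by
      apply div_lt_div_of_pos_left <;> nlinarith
    linarith
  obtain ⟨N, hN⟩ := exists_nat_gt (1 / δ)
  have hNδ : 1 / (2 * ((N + 1 : ℕ) : ℝ) + 1) < δ := by
    rw [div_lt_iff₀ hδ0] at hN
    rw [div_lt_iff₀ (by positivity)]
    push_cast
    nlinarith
  refine ⟨N + 1, ?_⟩
  have hge : ∑ n ∈ Finset.range (N + 1), 2 / (4 * ((n : ℝ) + 1) ^ 2 - 1) + δ ≤
      ∑ n ∈ Finset.range (N + 1), 2 / (β ^ 2 * ((n : ℝ) + 1) ^ 2 - 1) := by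
    rw [Finset.sum_range_succ', Finset.sum_range_succ']
    have h0 : (2 : ℝ) / (4 * (((0 : ℕ) : ℝ) + 1) ^ 2 - 1) + δ =
        2 / (β ^ 2 * (((0 : ℕ) : ℝ) + 1) ^ 2 - 1) := by
      rw [hδ]; norm_num
    rw [add_assoc, h0]
    gcongr with n _
    · have h1 : (1 : ℝ) ≤ (((n + 1 : ℕ) : ℝ) + 1) ^ 2 := by
        push_cast; nlinarith [(Nat.cast_nonneg n : (0 : ℝ) ≤ n)]
      nlinarith
    · nlinarith
  rw [htel] at hge
  have : ∑ n ∈ Finset.range (N + 1), 2 * β / (β ^ 2 * ((n : ℝ) + 1) ^ 2 - 1) =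
      β * ∑ n ∈ Finset.range (N + 1), 2 / (β ^ 2 * ((n : ℝ) + 1) ^ 2 - 1) := by
    rw [Finset.mul_sum]
    refine Finset.sum_congr rfl fun n _ => by ring
  rw [this]
  nlinarith

end BK

namespace BK
open Module

lemma floor_integral (G : ℕ → ℝ) (M : ℕ) :
    ∫ y in (0 : ℝ)..(M : ℝ), G ⌊y⌋₊ = ∑ j ∈ Finset.range M, G j := by
  have hle : ∀ j : ℕ, (j : ℝ) ≤ ((j + 1 : ℕ) : ℝ) := fun j => by push_cast; linarith
  have hfl : ∀ j : ℕ, Set.EqOn (fun y : ℝ => G ⌊y⌋₊) (fun _ => G j)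
      (Set.Ioo (j : ℝ) ((j + 1 : ℕ) : ℝ)) := by
    intro j y hy
    have h0 : (0 : ℝ) ≤ y := le_trans (Nat.cast_nonneg j) hy.1.le
    have : ⌊y⌋₊ = j := by
      rw [Nat.floor_eq_iff h0]
      refine ⟨hy.1.le, ?_⟩
      have := hy.2
      push_cast at this
      exact this
    simp [this]
  have hint : ∀ j < M, IntervalIntegrable (fun y : ℝ => G ⌊y⌋₊) volume (j : ℝ)
      ((j + 1 : ℕ) : ℝ) := by
    intro j _
    rw [intervalIntegrable_iff_integrableOn_Ioo_of_le (hle j)]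
    refine IntegrableOn.congr_fun (f := fun _ => G j) ?_ (hfl j).symm measurableSet_Ioo
    exact integrableOn_const (by simp)
  have h := intervalIntegral.sum_integral_adjacent_intervals (a := fun j : ℕ => (j : ℝ)) hint
  rw [Nat.cast_zero] at h
  rw [← h]
  refine Finset.sum_congr rfl fun j _ => ?_
  rw [intervalIntegral.integral_of_le (hle j), integral_Ioc_eq_integral_Ioo,
    setIntegral_congr_fun measurableSet_Ioo (hfl j)]
  simp

lemma floor_nonneg (G : ℕ → ℝ) (n : ℕ) (hn : 1 ≤ n)
    (hi : IntegrableOn (fun y : ℝ => G ⌊(n : ℝ) * y⌋₊) (Set.Ioi 0))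
    (hG : ∀ η : ℝ, 0 < η → ∀ᶠ M in atTop, -η ≤ ∑ j ∈ Finset.range M, G j) :
    0 ≤ ∫ y in Set.Ioi (0 : ℝ), G ⌊(n : ℝ) * y⌋₊ := by
  have hn0 : (0 : ℝ) < n := by exact_mod_cast hn
  have hlim : Tendsto (fun M : ℕ => (M : ℝ) / n) atTop atTop :=
    tendsto_natCast_atTop_atTop.atTop_div_const hn0
  have ht := intervalIntegral_tendsto_integral_Ioi (0 : ℝ) hi hlim
  have he : ∀ M : ℕ, ∫ y in (0 : ℝ)..(M : ℝ) / n, G ⌊(n : ℝ) * y⌋₊ =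
      (n : ℝ)⁻¹ * ∑ j ∈ Finset.range M, G j := by
    intro M
    rw [intervalIntegral.integral_comp_mul_left (fun y => G ⌊y⌋₊) hn0.ne', mul_zero,
      mul_div_cancel₀ _ hn0.ne', floor_integral, smul_eq_mul]
  simp only [he] at ht
  have key : ∀ η : ℝ, 0 < η → -η ≤ ∫ y in Set.Ioi (0 : ℝ), G ⌊(n : ℝ) * y⌋₊ := by
    intro η hη
    refine ge_of_tendsto ht ?_
    filter_upwards [hG η hη] with M hM
    have h1 : (n : ℝ)⁻¹ ≤ 1 := inv_le_one_of_one_le₀ (by exact_mod_cast hn)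
    have h2 : 0 ≤ (n : ℝ)⁻¹ := by positivity
    nlinarith [mul_le_mul_of_nonneg_left hM h2]
  by_contra hneg
  push Not at hneg
  have := key (-(∫ y in Set.Ioi (0 : ℝ), G ⌊(n : ℝ) * y⌋₊) / 2) (by linarith)
  linarith

/-- the truncated logarithm -/
noncomputable def Fu (N : ℕ) (u : ℂ) (t : ℝ) : ℝ := max (Real.log ‖1 - (t : ℂ) * u‖) (hN N t)

lemma norm_ge_im {u : ℂ} (hu : ‖u‖ = 1) (t : ℝ) : |u.im| ≤ ‖1 - (t : ℂ) * u‖ := by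
  have hc : (starRingEnd ℂ u) * u = 1 := by
    rw [mul_comm, Complex.mul_conj', hu]; norm_num
  have : ‖1 - (t : ℂ) * u‖ = ‖starRingEnd ℂ u - t‖ := by
    have e : 1 - (t : ℂ) * u = (starRingEnd ℂ u - t) * u := by rw [sub_mul, hc]
    rw [e, norm_mul, hu, mul_one]
  rw [this]
  refine le_trans (le_of_eq ?_) (Complex.abs_im_le_norm _)
  simp

lemma norm_le_one_add {u : ℂ} (hu : ‖u‖ = 1) {t : ℝ} (ht : 0 ≤ t) :
    ‖1 - (t : ℂ) * u‖ ≤ 1 + t := by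
  refine (norm_sub_le _ _).trans (le_of_eq ?_)
  rw [norm_mul, hu, mul_one, Complex.norm_real, Real.norm_of_nonneg ht, norm_one]

lemma Fu_le {N : ℕ} {u : ℂ} (hu : ‖u‖ = 1) (hi : u.im ≠ 0) {t : ℝ} (ht : 0 ≤ t) :
    Fu N u t ≤ Real.log (1 + t) := by
  refine max_le ?_ (hN_le N ht)
  exact Real.log_le_log (lt_of_lt_of_le (abs_pos.mpr hi) (norm_ge_im hu t)) (norm_le_one_add hu ht)

lemma Fu_abs {N : ℕ} {u : ℂ} (hu : ‖u‖ = 1) (hi : u.im ≠ 0) {t : ℝ} (ht : 0 ≤ t) :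
    |Fu N u t| ≤ (1 + 2 * N) * Real.log (1 + t) := by
  have h1 := Fu_le (N := N) hu hi ht
  have h2 : hN N t ≤ Fu N u t := le_max_right _ _
  have h3 := le_hN N ht
  have h4 : 0 ≤ Real.log (1 + t) := Real.log_nonneg (by linarith)
  have h5 : 0 ≤ (2 * N) * Real.log (1 + t) := by positivity
  rw [abs_le]
  constructor <;> linarith

lemma Fu_cont {N : ℕ} {u : ℂ} (hu : ‖u‖ = 1) (hi : u.im ≠ 0) {t : ℝ} (ht : 0 < t) :
    ContinuousAt (Fu N u) t := by
  unfold Fu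
  refine Filter.Tendsto.max (ContinuousAt.log (f := fun t : ℝ => ‖1 - (t : ℂ) * u‖) (by fun_prop) ?_) (hN_cont N ht)
  exact (lt_of_lt_of_le (abs_pos.mpr hi) (norm_ge_im hu t)).ne'

lemma Fu_meas (N : ℕ) (u : ℂ) : Measurable (Fu N u) := by
  unfold Fu
  have := hN_meas N
  fun_prop

section lim
variable {l c d : ℕ → ℝ} {μ : (N : ℕ) → Fin N → ℂ}

/-- For every direction `u` the lower bound on the determinant passes to the logarithmic sum. -/
lemma sum_lower (h : TData l c d μ) (hc0 : ∀ j, 0 ≤ c j) (hc : Summable c) (hd0 : ∀ j, 0 ≤ d j)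
    (N : ℕ) (u : ℂ) (hu : ‖u‖ = 1) (hi : u.im ≠ 0) (r : ℝ) (hr : 0 ≤ r) (η : ℝ) (hη : 0 < η) :
    ∀ᶠ M in atTop, -η ≤ ∑ j ∈ Finset.range M,
      (Fu N u (r * l j) + Real.log (1 + |u.im|⁻¹ * (r * d j))) := by
  filter_upwards [low_bound h hc0 hc ((r : ℂ) * u) η hη] with M hM
  have hC : 0 < |u.im| := abs_pos.mpr hi
  have he : ∀ j, 1 - (r : ℂ) * u * (l j : ℂ) = 1 - ((r * l j : ℝ) : ℂ) * u := fun j => by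
    push_cast; ring
  have hn : ‖(r : ℂ) * u‖ = r := by
    rw [norm_mul, hu, mul_one, Complex.norm_real, Real.norm_of_nonneg hr]
  have h1 := hM.trans (h.fac M ((r : ℂ) * u) |u.im|⁻¹ (by positivity) (fun j => by
    rw [he, inv_mul_eq_div, one_le_div hC]
    exact norm_ge_im hu _))
  rw [← Finset.prod_mul_distrib] at h1
  have h2 : ∏ j ∈ Finset.range M, (‖1 - (r : ℂ) * u * (l j : ℂ)‖ *
      (1 + |u.im|⁻¹ * ‖(r : ℂ) * u‖ * d j)) ≤ Real.exp (∑ j ∈ Finset.range M,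
      (Fu N u (r * l j) + Real.log (1 + |u.im|⁻¹ * (r * d j)))) := by
    rw [Real.exp_sum]
    have hp : ∀ j, 0 < ‖1 - (r : ℂ) * u * (l j : ℂ)‖ := fun j => by
      rw [he]; exact lt_of_lt_of_le hC (norm_ge_im hu _)
    have hq : ∀ j, 0 < 1 + |u.im|⁻¹ * (r * d j) := fun j => by
      have := hd0 j; positivity
    refine Finset.prod_le_prod (fun j _ => ?_) fun j _ => ?_
    · have := hd0 j; positivity
    · rw [Real.exp_add, Real.exp_log (hq j), hn, mul_assoc |u.im|⁻¹ r (d j)]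
      refine mul_le_mul_of_nonneg_right ?_ (hq j).le
      rw [← Real.log_le_iff_le_exp (hp j), he]
      exact le_max_left _ _
  exact Real.exp_le_exp.mp (h1.trans h2)

lemma bdd_of_tendsto {f : ℕ → ℝ} {a : ℝ} (h : Tendsto f atTop (𝓝 a)) :
    ∃ A : ℝ, 0 ≤ A ∧ ∀ j, f j ≤ A := by
  obtain ⟨A, hA⟩ := h.bddAbove_range
  exact ⟨max A 0, le_max_right _ _, fun j => (hA ⟨j, rfl⟩).trans (le_max_left _ _)⟩

lemma floor_le (β A : ℝ) (hβ : 0 < β) (f : ℕ → ℝ) (hA0 : 0 ≤ A)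
    (hA : ∀ j : ℕ, ((j : ℝ) + 1) ^ β * f j ≤ A) (n : ℕ) (hn : 1 ≤ n) (y : ℝ) (hy : 0 < y) :
    (n : ℝ) ^ β * f ⌊(n : ℝ) * y⌋₊ ≤ A * y ^ (-β) := by
  have hn0 : (0 : ℝ) < n := by exact_mod_cast hn
  set j := ⌊(n : ℝ) * y⌋₊ with hj
  have h1 : (n : ℝ) * y ≤ (j : ℝ) + 1 := (Nat.lt_floor_add_one _).le
  have h2 : ((n : ℝ) * y) ^ β ≤ ((j : ℝ) + 1) ^ β := by gcongr
  have hpos : 0 < ((j : ℝ) + 1) ^ β := by positivity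
  have h3 : f j ≤ A / ((j : ℝ) + 1) ^ β := by
    rw [le_div_iff₀ hpos]; linarith [hA j]
  calc (n : ℝ) ^ β * f j ≤ (n : ℝ) ^ β * (A / ((j : ℝ) + 1) ^ β) := by gcongr
    _ ≤ (n : ℝ) ^ β * (A / ((n : ℝ) * y) ^ β) := by gcongr
    _ = A * y ^ (-β) := by
      rw [Real.mul_rpow hn0.le hy.le, Real.rpow_neg hy.le]
      field_simp

lemma floor_tendsto (β a : ℝ) (hβ : 0 < β) (f : ℕ → ℝ)
    (hf : Tendsto (fun j : ℕ => ((j : ℝ) + 1) ^ β * f j) atTop (𝓝 a)) (y : ℝ) (hy : 0 < y) :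
    Tendsto (fun n : ℕ => (n : ℝ) ^ β * f ⌊(n : ℝ) * y⌋₊) atTop (𝓝 (a * y ^ (-β))) := by
  have hny : Tendsto (fun n : ℕ => (n : ℝ) * y) atTop atTop :=
    tendsto_natCast_atTop_atTop.atTop_mul_const hy
  have hfl : Tendsto (fun n : ℕ => ⌊(n : ℝ) * y⌋₊) atTop atTop :=
    tendsto_nat_floor_atTop.comp hny
  have h1 := hf.comp hfl
  have h2 : Tendsto (fun n : ℕ => ((⌊(n : ℝ) * y⌋₊ : ℝ) + 1) / ((n : ℝ) * y)) atTop (𝓝 1) := by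
    have h3 := (tendsto_nat_floor_div_atTop (R := ℝ)).comp hny
    have h4 := h3.add (tendsto_inv_atTop_zero.comp hny)
    rw [add_zero] at h4
    refine h4.congr fun n => ?_
    simp only [Function.comp]
    rw [add_div, one_div]
  have h3 := (h2.rpow_const (p := -β) (Or.inl one_ne_zero))
  rw [Real.one_rpow] at h3
  have h4 := (h1.mul h3).mul_const (y ^ (-β))
  rw [mul_one] at h4
  refine h4.congr' ?_
  filter_upwards [eventually_gt_atTop 0] with n hn
  have hn0 : (0 : ℝ) < n := by exact_mod_cast hn
  simp only [Function.comp]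
  have hj : (0 : ℝ) < (⌊(n : ℝ) * y⌋₊ : ℝ) + 1 := by positivity
  rw [Real.div_rpow hj.le (by positivity), Real.rpow_neg hj.le, Real.mul_rpow hn0.le hy.le,
    Real.rpow_neg hn0.le]
  have : 0 < ((⌊(n : ℝ) * y⌋₊ : ℝ) + 1) ^ β := by positivity
  have : 0 < y ^ (-β) := by positivity
  field_simp

lemma int_nonneg (h : TData l c d μ) (hc0 : ∀ j, 0 ≤ c j) (hc : Summable c) (hd0 : ∀ j, 0 ≤ d j)
    (hl0 : ∀ j, 0 ≤ l j) (β a : ℝ) (hβ : 1 < β) (ha : 0 < a)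
    (hl : Tendsto (fun j : ℕ => ((j : ℝ) + 1) ^ β * l j) atTop (𝓝 a))
    (hd : Tendsto (fun j : ℕ => ((j : ℝ) + 1) ^ β * d j) atTop (𝓝 0))
    (N : ℕ) (u : ℂ) (hu : ‖u‖ = 1) (hi : u.im ≠ 0) :
    0 ≤ ∫ y in Set.Ioi (0 : ℝ), Fu N u (y ^ (-β)) := by
  have hβ0 : 0 < β := by linarith
  set C := |u.im|⁻¹ with hC
  have hC0 : 0 < C := inv_pos.mpr (abs_pos.mpr hi)
  obtain ⟨A, hA0, hA⟩ := bdd_of_tendsto hl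
  obtain ⟨A', hA0', hA'⟩ := bdd_of_tendsto hd
  let r : ℕ → ℝ := fun n => (n : ℝ) ^ β / a
  have hr0 : ∀ n, 0 ≤ r n := fun n => by positivity
  let G : ℕ → ℕ → ℝ := fun n j => Fu N u (r n * l j) + Real.log (1 + C * (r n * d j))
  let D : ℝ → ℝ := fun y => (1 + 2 * N) * Real.log (1 + A / a * y ^ (-β)) +
    Real.log (1 + C * (A' / a) * y ^ (-β))
  have hD : IntegrableOn D (Set.Ioi 0) :=
    ((integ_log β (A / a) hβ (by positivity)).const_mul _).add
      (integ_log β (C * (A' / a)) hβ (by positivity))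
  have hmeas : ∀ n, Measurable (fun y : ℝ => G n ⌊(n : ℝ) * y⌋₊) := fun n =>
    (measurable_from_nat (f := G n)).comp
      (Nat.measurable_floor.comp (measurable_const_mul (n : ℝ)))
  have hrl : ∀ n : ℕ, 1 ≤ n → ∀ y : ℝ, 0 < y → ∀ (f : ℕ → ℝ) (A : ℝ), 0 ≤ A →
      (∀ j : ℕ, ((j : ℝ) + 1) ^ β * f j ≤ A) →
      r n * f ⌊(n : ℝ) * y⌋₊ ≤ A / a * y ^ (-β) := by
    intro n hn y hy f A hA0 hA
    have := floor_le β A hβ0 f hA0 hA n hn y hy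
    calc r n * f ⌊(n : ℝ) * y⌋₊ = ((n : ℝ) ^ β * f ⌊(n : ℝ) * y⌋₊) / a := by
          simp only [r]; ring
      _ ≤ (A * y ^ (-β)) / a := by gcongr
      _ = _ := by ring
  have hbound : ∀ n : ℕ, 1 ≤ n → ∀ᵐ y ∂(volume.restrict (Set.Ioi (0 : ℝ))),
      ‖G n ⌊(n : ℝ) * y⌋₊‖ ≤ D y := by
    intro n hn
    filter_upwards [ae_restrict_mem measurableSet_Ioi] with y hy
    have hy0 : 0 < y := hy
    have h1 := hrl n hn y hy0 l A hA0 hA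
    have h2 := hrl n hn y hy0 d A' hA0' hA'
    set j := ⌊(n : ℝ) * y⌋₊
    have h3 : 0 ≤ r n * l j := mul_nonneg (hr0 n) (hl0 j)
    have h4 : 0 ≤ r n * d j := mul_nonneg (hr0 n) (hd0 j)
    refine (norm_add_le _ _).trans (add_le_add ?_ ?_)
    · refine (Fu_abs hu hi h3).trans ?_
      gcongr
    · have h5 : 0 ≤ C * (r n * d j) := by positivity
      rw [Real.norm_of_nonneg (Real.log_nonneg (by linarith))]
      refine Real.log_le_log (by linarith) ?_
      have := mul_le_mul_of_nonneg_left h2 hC0.le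
      linarith
  have hlim : Tendsto (fun n : ℕ => ∫ y in Set.Ioi (0 : ℝ), G n ⌊(n : ℝ) * y⌋₊) atTop
      (𝓝 (∫ y in Set.Ioi (0 : ℝ), Fu N u (y ^ (-β)))) := by
    refine tendsto_integral_filter_of_dominated_convergence D ?_ ?_ hD ?_
    · exact Eventually.of_forall fun n => (hmeas n).aestronglyMeasurable
    · filter_upwards [eventually_ge_atTop 1] with n hn using hbound n hn
    · filter_upwards [ae_restrict_mem measurableSet_Ioi] with y hy
      have hy0 : 0 < y := hy
      have h1 : Tendsto (fun n : ℕ => r n * l ⌊(n : ℝ) * y⌋₊) atTop (𝓝 (y ^ (-β))) := by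
        have := (floor_tendsto β a hβ0 l hl y hy0).div_const a
        rw [mul_div_cancel_left₀ _ ha.ne'] at this
        refine this.congr fun n => ?_
        simp only [r]; ring
      have h2 : Tendsto (fun n : ℕ => r n * d ⌊(n : ℝ) * y⌋₊) atTop (𝓝 0) := by
        have := (floor_tendsto β 0 hβ0 d hd y hy0).div_const a
        rw [zero_mul, zero_div] at this
        refine this.congr fun n => ?_
        simp only [r]; ring
      have h3 := (Fu_cont (N := N) hu hi (t := y ^ (-β)) (by positivity)).tendsto.comp h1
      have h4 : Tendsto (fun n : ℕ => Real.log (1 + C * (r n * d ⌊(n : ℝ) * y⌋₊))) atTop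
          (𝓝 (Real.log (1 + C * 0))) :=
        ((h2.const_mul C).const_add 1).log (by norm_num)
      have h5 := h3.add h4
      simpa using h5
  refine ge_of_tendsto hlim ?_
  filter_upwards [eventually_ge_atTop 1] with n hn
  refine floor_nonneg (G n) n hn ?_ fun η hη =>
    sum_lower h hc0 hc hd0 N u hu hi (r n) (hr0 n) η hη
  exact Integrable.mono' hD (hmeas n).aestronglyMeasurable (hbound n hn)

lemma stepC (h : TData l c d μ) (hc0 : ∀ j, 0 ≤ c j) (hc : Summable c) (hd0 : ∀ j, 0 ≤ d j)
    (hl0 : ∀ j, 0 ≤ l j) (β a : ℝ) (hβ : 1 < β) (hβ2 : β < 2) (ha : 0 < a)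
    (hl : Tendsto (fun j : ℕ => ((j : ℝ) + 1) ^ β * l j) atTop (𝓝 a))
    (hd : Tendsto (fun j : ℕ => ((j : ℝ) + 1) ^ β * d j) atTop (𝓝 0)) : False := by
  obtain ⟨N, hN⟩ := exists_neg β hβ hβ2
  rw [← hN_integral β hβ N] at hN
  let x : ℕ → ℝ := fun k => 1 / ((k : ℝ) + 1)
  let u : ℕ → ℂ := fun k => Complex.exp ((x k : ℝ) * Complex.I)
  have hu : ∀ k, ‖u k‖ = 1 := fun k => Complex.norm_exp_ofReal_mul_I _
  have hi : ∀ k, (u k).im ≠ 0 := by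
    intro k
    have h0 : 0 < x k := by positivity
    have h1 : x k ≤ 1 := by
      simp only [x]
      rw [div_le_one (by positivity)]
      linarith [(Nat.cast_nonneg k : (0 : ℝ) ≤ k)]
    have : (u k).im = Real.sin (x k) := by simp only [u, Complex.exp_ofReal_mul_I_im]
    rw [this]
    exact (Real.sin_pos_of_pos_of_lt_pi h0 (by linarith [Real.pi_gt_three])).ne'
  have hul : Tendsto u atTop (𝓝 1) := by
    have h1 : Tendsto x atTop (𝓝 0) := tendsto_one_div_add_atTop_nhds_zero_nat
    have h2 : Continuous fun t : ℝ => Complex.exp ((t : ℂ) * Complex.I) := by fun_prop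
    have := (h2.tendsto 0).comp h1
    have e : Complex.exp (((0 : ℝ) : ℂ) * Complex.I) = 1 := by simp
    rw [e] at this
    exact this
  have hlim : Tendsto (fun k => ∫ y in Set.Ioi (0 : ℝ), Fu N (u k) (y ^ (-β))) atTop
      (𝓝 (∫ y in Set.Ioi (0 : ℝ), BK.hN N (y ^ (-β)))) := by
    refine tendsto_integral_of_dominated_convergence
      (fun y => (1 + 2 * N) * Real.log (1 + 1 * y ^ (-β))) ?_ ?_ ?_ ?_
    · exact fun k => ((Fu_meas N (u k)).comp
        (by fun_prop : Measurable fun y : ℝ => y ^ (-β))).aestronglyMeasurable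
    · exact (integ_log β 1 hβ zero_le_one).const_mul _
    · intro k
      filter_upwards [ae_restrict_mem measurableSet_Ioi] with y hy
      have hy0 : 0 < y := hy
      rw [one_mul]
      exact Fu_abs (hu k) (hi k) (by positivity)
    · have hne : ∀ᵐ y ∂(volume.restrict (Set.Ioi (0 : ℝ))), y ≠ 1 :=
        ae_restrict_of_ae (Measure.ae_ne volume 1)
      filter_upwards [ae_restrict_mem measurableSet_Ioi, hne] with y hy hy1
      have hy0 : 0 < y := hy
      set t := y ^ (-β) with ht
      have ht0 : 0 < t := by positivity
      have ht1 : t ≠ 1 := by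
        intro h1
        have h2 := congrArg Real.log h1
        rw [ht, Real.log_rpow hy0, Real.log_one] at h2
        rcases mul_eq_zero.mp h2 with h3 | h3
        · linarith
        · exact hy1 (Real.eq_one_of_pos_of_log_eq_zero hy0 h3)
      have h1 : Tendsto (fun k => ‖1 - (t : ℂ) * u k‖) atTop (𝓝 |1 - t|) := by
        have := ((hul.const_mul (t : ℂ)).const_sub 1).norm
        rw [mul_one] at this
        have e : ‖(1 : ℂ) - t‖ = |1 - t| := by
          rw [← Complex.ofReal_one, ← Complex.ofReal_sub, Complex.norm_real, Real.norm_eq_abs]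
        rwa [e] at this
      have h2 := (h1.log (abs_pos.mpr (sub_ne_zero.mpr ht1.symm)).ne').max
        (tendsto_const_nhds (x := BK.hN N t))
      rw [max_eq_right (log_le_hN N ht0 ht1)] at h2
      exact h2
  have := ge_of_tendsto' hlim fun k => int_nonneg h hc0 hc hd0 hl0 β a hβ ha hl hd N (u k)
    (hu k) (hi k)
  linarith

end lim
end BK

set_option linter.unusedSimpArgs false
set_option linter.unusedSectionVars false

namespace BK
open Module

/-- Enumerate a family of reals with finite upper level sets in decreasing order. -/
lemma enum_desc {ι : Type*} [Infinite ι] (lam : ι → ℝ)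
    (hfin : ∀ i, {j | lam i ≤ lam j}.Finite) : ∃ e : ℕ ≃ ι, Antitone (fun n => lam (e n)) := by
  classical
  let wo : LinearOrder ι := linearOrderOfSTO (WellOrderingRel (α := ι))
  let f : ι → ℝᵒᵈ ×ₗ ι := fun i => toLex (OrderDual.toDual (lam i), i)
  have hf : Function.Injective f := fun i j h => by
    have := congrArg (fun p => (ofLex p).2) h
    exact this
  have hlt : ∀ i j, f i ≤ f j → lam j ≤ lam i := by
    intro i j h
    rw [Prod.Lex.le_iff] at h
    rcases h with h | h
    · exact (OrderDual.toDual_lt_toDual.mp h).le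
    · exact (OrderDual.toDual_inj.mp h.1).ge
  let J := Set.range f
  have hbelow : ∀ y : J, {x : J | x ≤ y}.Finite := by
    rintro ⟨_, i, rfl⟩
    refine (((hfin i).image fun k => (⟨f k, k, rfl⟩ : J))).subset ?_
    rintro ⟨_, k, rfl⟩ hx
    exact ⟨k, hlt _ _ hx, rfl⟩
  let : LocallyFiniteOrder J := LocallyFiniteOrder.ofFiniteIcc fun a b =>
    (hbelow b).subset fun x hx => hx.2
  have : Infinite J := Set.infinite_coe_iff.mpr (Set.infinite_range_of_injective hf)
  obtain ⟨y0⟩ : Nonempty J := inferInstance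
  obtain ⟨m, hm, hm2⟩ := Set.exists_min_image _ id (hbelow y0) ⟨y0, show y0 ≤ y0 from le_rfl⟩
  have hbot : ∀ x : J, m ≤ x := fun x => by
    rcases le_total x y0 with h | h
    · exact hm2 x h
    · exact le_trans hm h
  let : OrderBot J := @OrderBot.mk J _ ⟨m⟩ hbot
  have : NoMaxOrder J := ⟨fun y => by
    by_contra hc
    push Not at hc
    exact Set.infinite_univ ((hbelow y).subset fun x _ => hc x)⟩
  let : SuccOrder J := LinearLocallyFiniteOrder.succOrder J
  let : PredOrder J := LinearLocallyFiniteOrder.predOrder J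
  let o : J ≃o ℕ := orderIsoNatOfLinearSuccPredArch
  let e : ℕ ≃ ι := o.toEquiv.symm.trans (Equiv.ofInjective f hf).symm
  refine ⟨e, fun n k hnk => hlt _ _ ?_⟩
  have h : ∀ n, f (e n) = (o.symm n).1 := fun n => Equiv.apply_ofInjective_symm hf _
  rw [h, h]
  exact o.symm.monotone hnk

variable {H : Type*} [NormedAddCommGroup H] [InnerProductSpace ℂ H] [CompleteSpace H]

/-- An eigenbasis of a compact self-adjoint operator. -/
lemma eigenbasis {B : H →L[ℂ] H} (hc : IsCompactOperator B) (hB : B.IsPositive)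
    (hinj : Function.Injective B) :
    ∃ (ι : Type) (b : HilbertBasis ι ℂ H) (lam : ι → ℝ), (∀ i, 0 < lam i) ∧
      ∀ i, B (b i) = (lam i : ℂ) • b i := by
  have hs : (B : H →ₗ[ℂ] H).IsSymmetric := hB.isSymmetric
  let E : ℂ → Submodule ℂ H := fun μ => Module.End.eigenspace (B : H →ₗ[ℂ] H) μ
  have hfd : ∀ μ, FiniteDimensional ℂ (E μ) := by
    intro μ
    by_cases h : μ = 0
    · have : E μ = ⊥ := by
        rw [eq_bot_iff]
        intro x hx
        have h1 : B x = μ • x := Module.End.mem_eigenspace_iff.mp hx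
        rw [h, zero_smul] at h1
        exact hinj (by rw [h1, map_zero])
      rw [this]; infer_instance
    · exact ContinuousLinearMap.finite_dimensional_eigenspace hc μ h
  let v : (a : Σ μ, Fin (finrank ℂ (E μ))) → H := fun a => (stdOrthonormalBasis ℂ (E a.1) a.2 : H)
  have hv : Orthonormal ℂ v := hs.orthogonalFamily_eigenspaces.orthonormal_sigma_orthonormal
    (v_family := fun μ => stdOrthonormalBasis ℂ (E μ)) fun μ => (stdOrthonormalBasis ℂ (E μ)).orthonormal
  have hsp : (Submodule.span ℂ (Set.range v))ᗮ = ⊥ := by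
    rw [eq_bot_iff, ← ContinuousLinearMap.orthogonalComplement_iSup_eigenspaces_eq_bot hc hs]
    refine Submodule.orthogonal_le (iSup_le fun μ x hx => ?_)
    have h1 := (stdOrthonormalBasis ℂ (E μ)).sum_repr ⟨x, hx⟩
    have h2 := congrArg (Subtype.val) h1
    rw [Submodule.coe_sum] at h2
    change _ = x at h2
    rw [← h2]
    refine Submodule.sum_mem _ fun i _ => ?_
    exact Submodule.smul_mem _ _ (Submodule.subset_span ⟨⟨μ, i⟩, rfl⟩)
  let b := HilbertBasis.mkOfOrthogonalEqBot hv hsp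
  have hb : ∀ a, b a = v a := fun a => by simp [b]
  have hBv : ∀ a, B (v a) = a.1 • v a := fun a =>
    Module.End.mem_eigenspace_iff.mp (stdOrthonormalBasis ℂ (E a.1) a.2).2
  have hpos : ∀ a : (Σ μ, Fin (finrank ℂ (E μ))), 0 ≤ a.1.re ∧ a.1 = (a.1.re : ℂ) := by
    intro a
    have h1 := hB.inner_nonneg_right (v a)
    rw [hBv, inner_smul_right, inner_self_eq_norm_sq_to_K, hv.1 a] at h1
    simp only [RCLike.ofReal_one, one_pow, mul_one, Complex.coe_algebraMap, map_one] at h1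
    rw [Complex.le_def] at h1
    refine ⟨by simpa using h1.1, Complex.ext (by simp) ?_⟩
    simpa using h1.2.symm
  refine ⟨(Σ μ, Fin (finrank ℂ (E μ))), b, fun a => a.1.re, fun a => ?_, fun a => ?_⟩
  · refine lt_of_le_of_ne (hpos a).1 fun h0 => ?_
    have h1 := hBv a
    have h0 : 0 = a.1.re := h0
    rw [(hpos a).2, ← h0, Complex.ofReal_zero, zero_smul] at h1
    have h2 : v a = 0 := hinj (by rw [h1, map_zero])
    have := hv.1 a
    rw [h2, norm_zero] at this
    exact zero_ne_one this
  · rw [hb, hBv, ← (hpos a).2]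

/-- Eigenvalues of a compact operator in an orthonormal system tend to zero. -/
lemma level_finite {ι : Type*} {B : H →L[ℂ] H} (hc : IsCompactOperator B) {v : ι → H}
    (hv : Orthonormal ℂ v) {lam : ι → ℝ} (hB : ∀ i, B (v i) = (lam i : ℂ) • v i)
    (ε : ℝ) (hε : 0 < ε) : {j | ε ≤ lam j}.Finite := by
  by_contra hinf
  have hinf : Set.Infinite {j | ε ≤ lam j} := hinf
  let g := hinf.natEmbedding
  let x : ℕ → H := fun n => v (g n)
  obtain ⟨Q, hQ, hVQ⟩ := IsCompactOperator.image_closedBall_subset_compact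
    (f := (B : H →ₗ[ℂ] H)) hc 1
  obtain ⟨w, -, ψ, hψ, hw⟩ := hQ.tendsto_subseq (x := fun k => B (x k))
    (fun k => hVQ ⟨x k, by simp [x, hv.1], rfl⟩)
  have hcs := hw.cauchySeq
  rw [Metric.cauchySeq_iff] at hcs
  obtain ⟨N, hN⟩ := hcs ε hε
  have h1 := hN (N+1) (by omega) N le_rfl
  rw [dist_eq_norm] at h1
  have hne : (g (ψ (N+1)) : ι) ≠ g (ψ N) := fun h =>
    (hψ (Nat.lt_succ_self N)).ne' (g.injective (Subtype.ext h))
  simp only [Function.comp, x, hB] at h1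
  have h2 : inner ℂ (v (g (ψ (N+1)))) ((lam (g (ψ (N+1))) : ℂ) • v (g (ψ (N+1))) -
      (lam (g (ψ N)) : ℂ) • v (g (ψ N))) = (lam (g (ψ (N+1))) : ℂ) := by
    rw [inner_sub_right, inner_smul_right, inner_smul_right, hv.2 hne, inner_self_eq_norm_sq_to_K,
      hv.1]
    simp
  have h3 := norm_inner_le_norm (𝕜 := ℂ) (v (g (ψ (N+1)))) ((lam (g (ψ (N+1))) : ℂ) • v (g (ψ (N+1))) -
      (lam (g (ψ N)) : ℂ) • v (g (ψ N)))
  rw [h2, hv.1, one_mul, Complex.norm_real, Real.norm_eq_abs] at h3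
  have h4 : ε ≤ lam (g (ψ (N+1))) := (g (ψ (N+1))).2
  linarith [le_abs_self (lam (g (ψ (N+1))))]

lemma sNum_bdd (T : H →L[ℂ] H) (n : ℕ) : BddBelow (Set.range
    fun F : {F : H →L[ℂ] H // Module.rank ℂ (LinearMap.range (F : H →ₗ[ℂ] H)) < (n : Cardinal)} =>
    ‖T - (F : H →L[ℂ] H)‖) := ⟨0, by rintro _ ⟨F, rfl⟩; exact norm_nonneg _⟩

lemma sNum_nonneg (T : H →L[ℂ] H) (n : ℕ) : 0 ≤ sNum T n :=
  Real.iInf_nonneg fun _ => norm_nonneg _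

lemma sNum_le (T F : H →L[ℂ] H) (n : ℕ)
    (hF : Module.rank ℂ (LinearMap.range (F : H →ₗ[ℂ] H)) < (n : Cardinal)) :
    sNum T n ≤ ‖T - F‖ := ciInf_le (sNum_bdd T n) ⟨F, hF⟩

lemma sNum_anti (T : H →L[ℂ] H) {n k : ℕ} (h : n ≤ k) : sNum T (k + 1) ≤ sNum T (n + 1) := by
  have : Nonempty {F : H →L[ℂ] H // Module.rank ℂ (LinearMap.range (F : H →ₗ[ℂ] H)) <
      ((n + 1 : ℕ) : Cardinal)} := ⟨⟨0, by simp⟩⟩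
  refine le_ciInf fun F => sNum_le T F.1 _ (F.2.trans_le ?_)
  exact_mod_cast Nat.succ_le_succ h

/-- The singular values of a diagonal operator are its diagonal entries. -/
lemma sNum_diag (b : HilbertBasis ℕ ℂ H) {B : H →L[ℂ] H} {l : ℕ → ℝ} (hl0 : ∀ j, 0 ≤ l j)
    (hl : Antitone l) (hB : ∀ j, B (b j) = (l j : ℂ) • b j) (j : ℕ) :
    sNum B (j + 1) = l j := by
  apply le_antisymm
  · let P : H →L[ℂ] H := Jn b j ∘L (Jn b j).adjoint
    have hr : Module.rank ℂ (LinearMap.range ((B ∘L P : H →L[ℂ] H) : H →ₗ[ℂ] H)) <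
        ((j + 1 : ℕ) : Cardinal) := by
      have h1 : LinearMap.range ((B ∘L P : H →L[ℂ] H) : H →ₗ[ℂ] H) ≤
          LinearMap.range ((B ∘L Jn b j : EuclideanSpace ℂ (Fin j) →L[ℂ] H) :
            EuclideanSpace ℂ (Fin j) →ₗ[ℂ] H) := by
        rintro _ ⟨x, rfl⟩
        exact ⟨(Jn b j).adjoint x, rfl⟩
      refine (Submodule.rank_mono h1).trans_lt ?_
      have h2 := LinearMap.finrank_range_le
        ((B ∘L Jn b j : EuclideanSpace ℂ (Fin j) →L[ℂ] H) :
            EuclideanSpace ℂ (Fin j) →ₗ[ℂ] H)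
      rw [finrank_euclideanSpace_fin] at h2
      rw [← Module.finrank_eq_rank]
      exact_mod_cast Nat.lt_succ_of_le h2
    refine (sNum_le B _ _ hr).trans ?_
    refine ContinuousLinearMap.opNorm_le_bound _ (hl0 j) fun x => ?_
    have hBi : ∀ (i : ℕ) (y : H), inner ℂ (b i) (B y) = (l i : ℂ) * inner ℂ (b i) y := by
      intro i y
      have h1 := (b.hasSum_repr y).mapL ((innerSL ℂ (b i)) ∘L B)
      have h2 : HasSum (fun k => ((innerSL ℂ (b i)) ∘L B) (b.repr y k • b k))
          ((l i : ℂ) * inner ℂ (b i) y) := by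
        convert hasSum_single i ?_ using 1
        · simp [hB, b.repr_apply_apply, inner_smul_right, inner_self_eq_norm_sq_to_K,
            b.orthonormal.1 i, mul_comm]
        · intro k hk
          simp [hB, inner_smul_right, b.orthonormal.2 hk.symm]
      exact h1.unique h2
    have hPi : ∀ i : ℕ, inner ℂ (b i) (P x) = if i < j then inner ℂ (b i) x else 0 := by
      intro i
      change inner ℂ (b i) (Jn b j ((Jn b j).adjoint x)) = _
      rw [Jn_apply, inner_sum]
      simp_rw [inner_smul_right, Jn_adj_apply, orthonormal_iff_ite.mp b.orthonormal]
      split_ifs with hij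
      · rw [Finset.sum_eq_single ⟨i, hij⟩]
        · simp
        · intro k _ hk
          have : i ≠ k := fun h => hk (Fin.ext h.symm)
          simp [this]
        · simp
      · refine Finset.sum_eq_zero fun k _ => ?_
        have : i ≠ k := by have := k.2; omega
        simp [this]
    set y := (B - B ∘L P) x with hy
    have hyi : ∀ i, ‖inner ℂ (b i) y‖ ≤ l j * ‖inner ℂ (b i) x‖ := by
      intro i
      have : y = B x - B (P x) := rfl
      rw [this, inner_sub_right, hBi, hBi, hPi]
      split_ifs with h
      · simp only [sub_self, norm_zero]
        have := hl0 j; positivity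
      · rw [mul_zero, sub_zero, norm_mul, Complex.norm_real, Real.norm_of_nonneg (hl0 i)]
        exact mul_le_mul_of_nonneg_right (hl (not_lt.mp h)) (norm_nonneg _)
    have hsq : ∀ z : H, HasSum (fun i => ‖inner ℂ (b i) z‖ ^ 2) (‖z‖ ^ 2) := by
      intro z
      have h1 := b.hasSum_inner_mul_inner z z
      have h2 := h1.mapL Complex.reCLM
      convert h2 using 1
      · ext i
        rw [← inner_conj_symm z (b i)]
        simp only [Complex.reCLM_apply]
        rw [← Complex.normSq_eq_conj_mul_self, Complex.ofReal_re, Complex.normSq_eq_norm_sq]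
      · simp only [Complex.reCLM_apply]
        exact norm_sq_eq_re_inner (𝕜 := ℂ) z
    have h3 : ‖y‖ ^ 2 ≤ (l j * ‖x‖) ^ 2 := by
      rw [mul_pow]
      refine hasSum_le (fun i => ?_) (hsq y) ((hsq x).mul_left (l j ^ 2))
      rw [← mul_pow]
      exact pow_le_pow_left₀ (norm_nonneg _) (hyi i) 2
    exact le_of_sq_le_sq h3 (mul_nonneg (hl0 j) (norm_nonneg _))
  · have : Nonempty {F : H →L[ℂ] H // Module.rank ℂ (LinearMap.range (F : H →ₗ[ℂ] H)) <
      ((j + 1 : ℕ) : Cardinal)} := ⟨⟨0, by simp⟩⟩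
    refine le_ciInf fun F => ?_
    obtain ⟨F, hF⟩ := F
    have hfd : FiniteDimensional ℂ (LinearMap.range (F : H →ₗ[ℂ] H)) :=
      Module.rank_lt_aleph0_iff.mp (hF.trans Cardinal.natCast_lt_aleph0)
    rw [← Module.finrank_eq_rank] at hF
    have hF' : finrank ℂ (LinearMap.range (F : H →ₗ[ℂ] H)) < j + 1 := by exact_mod_cast hF
    let L : EuclideanSpace ℂ (Fin (j+1)) →ₗ[ℂ] LinearMap.range (F : H →ₗ[ℂ] H) :=
      (F : H →ₗ[ℂ] H).rangeRestrict ∘ₗ (Jn b (j+1) : _ →ₗ[ℂ] H)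
    have hk := LinearMap.ker_ne_bot_of_finrank_lt (f := L) (by
      rw [finrank_euclideanSpace_fin]; exact hF')
    obtain ⟨x, hx, hx0⟩ := Submodule.exists_mem_ne_zero_of_ne_bot hk
    have hFx : F (Jn b (j+1) x) = 0 := congrArg Subtype.val (show L x = 0 from hx)
    have hBx : B (Jn b (j+1) x) = Jn b (j+1) (dg (fun i : Fin (j+1) => (l i : ℂ)) x) := by
      rw [Jn_apply, Jn_apply, map_sum]
      refine Finset.sum_congr rfl fun i _ => ?_
      rw [map_smul, hB, dg_apply, smul_smul, mul_comm]
    have h1 : l j * ‖x‖ ≤ ‖dg (fun i : Fin (j+1) => (l i : ℂ)) x‖ := by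
      refine le_of_sq_le_sq ?_ (norm_nonneg _)
      rw [mul_pow, EuclideanSpace.norm_sq_eq, EuclideanSpace.norm_sq_eq, Finset.mul_sum]
      refine Finset.sum_le_sum fun i _ => ?_
      rw [dg_apply, norm_mul, mul_pow, Complex.norm_real, Real.norm_of_nonneg (hl0 i)]
      refine mul_le_mul_of_nonneg_right ?_ (by positivity)
      exact pow_le_pow_left₀ (hl0 j) (hl (by have := i.2; omega)) 2
    have h2 : l j * ‖x‖ ≤ ‖B - F‖ * ‖x‖ := by
      refine h1.trans ?_
      rw [← Jn_norm b.orthonormal, ← hBx, ← Jn_norm b.orthonormal (j+1) x]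
      have := (B - F).le_opNorm (Jn b (j+1) x)
      rwa [_root_.sub_apply, hFx, sub_zero] at this
    exact le_of_mul_le_mul_right h2 (norm_pos_iff.mpr hx0)

end BK

set_option linter.unusedSimpArgs false
set_option linter.unusedSectionVars false

namespace BK
open Module

lemma anti_summable {y : ℕ → ℝ} (hy : Antitone y) (h0 : ∀ n, 0 ≤ y n) (hs : Summable y) :
    Tendsto (fun n : ℕ => ((n : ℝ) + 1) * y n) atTop (𝓝 0) := by
  have h1 := hs.hasSum.tendsto_sum_nat
  have hd : Tendsto (fun n : ℕ => n / 2) atTop atTop := Nat.tendsto_div_const_atTop (by norm_num)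
  have h2 := ((h1.comp (tendsto_add_atTop_nat 1)).sub (h1.comp hd)).const_mul 2
  rw [sub_self, mul_zero] at h2
  refine squeeze_zero (fun n => by have := h0 n; positivity) (fun n => ?_) h2
  simp only [Function.comp]
  rw [← Finset.sum_Ico_eq_sub _ (by omega : n / 2 ≤ n + 1)]
  have h3 : (Finset.Ico (n / 2) (n + 1)).card • y n ≤ ∑ i ∈ Finset.Ico (n / 2) (n + 1), y i :=
    Finset.card_nsmul_le_sum _ _ _ fun i hi => hy (by have := (Finset.mem_Ico.mp hi).2; omega)
  rw [Nat.card_Ico, nsmul_eq_mul] at h3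
  have h4 : ((n : ℝ) + 1) ≤ 2 * ((n + 1 - n / 2 : ℕ) : ℝ) := by
    have : n + 1 ≤ 2 * (n + 1 - n / 2) := by omega
    exact_mod_cast this
  have := mul_le_mul_of_nonneg_right h4 (h0 n)
  linarith

lemma decay_of_summable {x : ℕ → ℝ} (hx : Antitone x) (h0 : ∀ n, 0 ≤ x n) {q α : ℝ} (hq : 0 < q)
    (hα : 0 < α) (hqα : q ≤ 1 / α) (hs : Summable fun n => x n ^ q) :
    Tendsto (fun n : ℕ => ((n : ℝ) + 1) ^ α * x n) atTop (𝓝 0) := by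
  have h1 := anti_summable (y := fun n => x n ^ q)
    (fun i j hij => Real.rpow_le_rpow (h0 j) (hx hij) hq.le) (fun n => Real.rpow_nonneg (h0 n) _) hs
  have h2 := h1.rpow_const (p := 1 / q) (Or.inr (by positivity))
  rw [Real.zero_rpow (by positivity)] at h2
  refine squeeze_zero (fun n => by have := h0 n; positivity) (fun n => ?_) h2
  have h3 : ((n : ℝ) + 1) ^ α ≤ ((n : ℝ) + 1) ^ (1 / q) := by
    refine Real.rpow_le_rpow_of_exponent_le (by linarith [(Nat.cast_nonneg n : (0 : ℝ) ≤ n)]) ?_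
    rw [le_div_iff₀ hq]
    rw [le_div_iff₀ hα] at hqα
    linarith
  rw [Real.mul_rpow (by positivity) (Real.rpow_nonneg (h0 n) _), ← Real.rpow_mul (h0 n),
    mul_one_div_cancel hq.ne', Real.rpow_one]
  exact mul_le_mul_of_nonneg_right h3 (h0 n)

lemma half_pow (β : ℝ) (hβ : 0 ≤ β) (n : ℕ) :
    ((n : ℝ) + 1) ^ β ≤ 2 ^ β * (((n / 2 : ℕ) : ℝ) + 1) ^ β := by
  rw [← Real.mul_rpow (by norm_num) (by positivity)]
  refine Real.rpow_le_rpow (by positivity) ?_ hβ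
  have : n + 1 ≤ 2 * (n / 2 + 1) := by omega
  exact_mod_cast this

variable {H : Type*} [NormedAddCommGroup H] [InnerProductSpace ℂ H] [CompleteSpace H]

/-- `s_n(T) = O(n^{-β})`. -/
def Big (β : ℝ) (T : H →L[ℂ] H) : Prop :=
  ∃ c, Apx T c ∧ ∃ A : ℝ, ∀ n : ℕ, ((n : ℝ) + 1) ^ β * c n ≤ A

/-- `s_n(T) = o(n^{-β})`. -/
def Sm (β : ℝ) (T : H →L[ℂ] H) : Prop :=
  ∃ c, Apx T c ∧ Tendsto (fun n : ℕ => ((n : ℝ) + 1) ^ β * c n) atTop (𝓝 0)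

lemma Sm.big {β : ℝ} {T : H →L[ℂ] H} (h : Sm β T) : Big β T := by
  obtain ⟨c, hc, hl⟩ := h
  obtain ⟨A, -, hA⟩ := bdd_of_tendsto hl
  exact ⟨c, hc, A, hA⟩

lemma half_le {β : ℝ} (hβ : 0 ≤ β) {c : ℕ → ℝ} (hc : ∀ n, 0 ≤ c n) (n : ℕ) :
    ((n : ℝ) + 1) ^ β * c (n / 2) ≤ 2 ^ β * ((((n / 2 : ℕ) : ℝ) + 1) ^ β * c (n / 2)) := by
  rw [← mul_assoc]
  exact mul_le_mul_of_nonneg_right (half_pow β hβ n) (hc _)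

lemma Big.add {β : ℝ} (hβ : 0 ≤ β) {S T : H →L[ℂ] H} (hS : Big β S) (hT : Big β T) :
    Big β (S + T) := by
  obtain ⟨c, hc, A, hA⟩ := hS
  obtain ⟨d, hd, D, hD⟩ := hT
  refine ⟨_, apx_add hc hd, 2 ^ β * A + 2 ^ β * D, fun n => ?_⟩
  rw [mul_add]
  have h2 : (0 : ℝ) ≤ 2 ^ β := by positivity
  exact add_le_add ((half_le hβ (apx_nonneg hc) n).trans (mul_le_mul_of_nonneg_left (hA _) h2))
    ((half_le hβ (apx_nonneg hd) n).trans (mul_le_mul_of_nonneg_left (hD _) h2))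

lemma half_tendsto : Tendsto (fun n : ℕ => n / 2) atTop atTop :=
  Nat.tendsto_div_const_atTop (by norm_num)

lemma Sm.add {β : ℝ} (hβ : 0 ≤ β) {S T : H →L[ℂ] H} (hS : Sm β S) (hT : Sm β T) :
    Sm β (S + T) := by
  obtain ⟨c, hc, hA⟩ := hS
  obtain ⟨d, hd, hD⟩ := hT
  refine ⟨_, apx_add hc hd, ?_⟩
  have h1 := ((hA.comp half_tendsto).const_mul (2 ^ β)).add
    ((hD.comp half_tendsto).const_mul (2 ^ β))
  simp only [mul_zero, add_zero] at h1
  refine squeeze_zero (fun n => ?_) (fun n => ?_) h1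
  · have := apx_nonneg hc (n / 2)
    have := apx_nonneg hd (n / 2)
    positivity
  · rw [mul_add]
    exact add_le_add (half_le hβ (apx_nonneg hc) n) (half_le hβ (apx_nonneg hd) n)

lemma mul_half_le {β γ : ℝ} (hβ : 0 ≤ β) (hγ : 0 ≤ γ) {c d : ℕ → ℝ} (hc : ∀ n, 0 ≤ c n)
    (hd : ∀ n, 0 ≤ d n) (n : ℕ) :
    ((n : ℝ) + 1) ^ (β + γ) * (c (n / 2) * d (n / 2)) ≤
      (2 ^ β * ((((n / 2 : ℕ) : ℝ) + 1) ^ β * c (n / 2))) *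
      (2 ^ γ * ((((n / 2 : ℕ) : ℝ) + 1) ^ γ * d (n / 2))) := by
  rw [Real.rpow_add (by positivity), mul_mul_mul_comm]
  have := hc (n / 2)
  have := hd (n / 2)
  exact mul_le_mul (half_le hβ hc n) (half_le hγ hd n) (by positivity) (by positivity)

lemma Big.mul {β γ : ℝ} (hβ : 0 ≤ β) (hγ : 0 ≤ γ) {S T : H →L[ℂ] H} (hS : Big β S)
    (hT : Big γ T) : Big (β + γ) (S * T) := by
  obtain ⟨c, hc, A, hA⟩ := hS
  obtain ⟨d, hd, D, hD⟩ := hT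
  have hc0 := apx_nonneg hc
  have hd0 := apx_nonneg hd
  refine ⟨_, apx_mul hc hd, (2 ^ β * A) * (2 ^ γ * D), fun n => ?_⟩
  refine (mul_half_le hβ hγ hc0 hd0 n).trans ?_
  have h1 : 0 ≤ ((((n / 2 : ℕ) : ℝ) + 1) ^ β * c (n / 2)) := by
    have := hc0 (n / 2); positivity
  have h2 : 0 ≤ ((((n / 2 : ℕ) : ℝ) + 1) ^ γ * d (n / 2)) := by
    have := hd0 (n / 2); positivity
  have h3 := h1.trans (hA _)
  gcongr
  · exact hA _
  · exact hD _

lemma bs_tendsto {f g : ℕ → ℝ} {A : ℝ} (hf0 : ∀ n, 0 ≤ f n) (hg0 : ∀ n, 0 ≤ g n)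
    (hf : ∀ n, f n ≤ A) (hg : Tendsto g atTop (𝓝 0)) :
    Tendsto (fun n => f n * g n) atTop (𝓝 0) := by
  have h1 := hg.const_mul A
  rw [mul_zero] at h1
  exact squeeze_zero (fun n => mul_nonneg (hf0 n) (hg0 n))
    (fun n => mul_le_mul_of_nonneg_right (hf n) (hg0 n)) h1

lemma Big.mul_sm {β γ : ℝ} (hβ : 0 ≤ β) (hγ : 0 ≤ γ) {S T : H →L[ℂ] H} (hS : Big β S)
    (hT : Sm γ T) : Sm (β + γ) (S * T) := by
  obtain ⟨c, hc, A, hA⟩ := hS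
  obtain ⟨d, hd, hD⟩ := hT
  have hc0 := apx_nonneg hc
  have hd0 := apx_nonneg hd
  refine ⟨_, apx_mul hc hd, ?_⟩
  have h1 := (hD.comp half_tendsto).const_mul (2 ^ γ)
  rw [mul_zero] at h1
  have h2 := bs_tendsto (f := fun n => (2 ^ β * ((((n / 2 : ℕ) : ℝ) + 1) ^ β * c (n / 2))))
    (A := 2 ^ β * A) (fun n => by have := hc0 (n / 2); positivity)
    (fun n => by have := hd0 (n / 2); simp only [Function.comp]; positivity)
    (fun n => mul_le_mul_of_nonneg_left (hA _) (by positivity)) h1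
  refine squeeze_zero (fun n => ?_) (fun n => mul_half_le hβ hγ hc0 hd0 n) h2
  have := hc0 (n / 2)
  have := hd0 (n / 2)
  positivity

lemma Sm.mul_big {β γ : ℝ} (hβ : 0 ≤ β) (hγ : 0 ≤ γ) {S T : H →L[ℂ] H} (hS : Sm β S)
    (hT : Big γ T) : Sm (β + γ) (S * T) := by
  obtain ⟨c, hc, hA⟩ := hS
  obtain ⟨d, hd, D, hD⟩ := hT
  have hc0 := apx_nonneg hc
  have hd0 := apx_nonneg hd
  refine ⟨_, apx_mul hc hd, ?_⟩
  have h1 := (hA.comp half_tendsto).const_mul (2 ^ β)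
  rw [mul_zero] at h1
  have h2 := bs_tendsto (f := fun n => (2 ^ γ * ((((n / 2 : ℕ) : ℝ) + 1) ^ γ * d (n / 2))))
    (A := 2 ^ γ * D) (fun n => by have := hd0 (n / 2); positivity)
    (fun n => by have := hc0 (n / 2); simp only [Function.comp]; positivity)
    (fun n => mul_le_mul_of_nonneg_left (hD _) (by positivity)) h1
  refine squeeze_zero (fun n => ?_) (fun n => ?_) h2
  · have := hc0 (n / 2)
    have := hd0 (n / 2)
    positivity
  · exact (mul_half_le hβ hγ hc0 hd0 n).trans (mul_comm _ _).le

lemma pow_data {α : ℝ} (hα : 0 < α) {B V : H →L[ℂ] H} (hB : Big α B) (hV : Big α V)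
    (hK : Sm α (V - B)) (k : ℕ) :
    Big (((k : ℝ) + 1) * α) (B ^ (k + 1)) ∧ Big (((k : ℝ) + 1) * α) (V ^ (k + 1)) ∧
      Sm (((k : ℝ) + 1) * α) (V ^ (k + 1) - B ^ (k + 1)) := by
  induction k with
  | zero => simpa using ⟨hB, hV, hK⟩
  | succ k ih =>
    obtain ⟨h1, h2, h3⟩ := ih
    have hβ : 0 ≤ ((k : ℝ) + 1) * α := by positivity
    have e : (((k + 1 : ℕ) : ℝ) + 1) * α = ((k : ℝ) + 1) * α + α := by push_cast; ring
    rw [e]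
    refine ⟨?_, ?_, ?_⟩
    · rw [pow_succ]; exact h1.mul hβ hα.le hB
    · rw [pow_succ]; exact h2.mul hβ hα.le hV
    · have : V ^ (k + 1 + 1) - B ^ (k + 1 + 1) =
          V ^ (k + 1) * (V - B) + (V ^ (k + 1) - B ^ (k + 1)) * B := by
        rw [pow_succ V (k + 1), pow_succ B (k + 1)]; noncomm_ring
      rw [this]
      exact (h2.mul_sm hβ hα.le hK).add (by positivity) (h3.mul_big hβ hα.le hB)

lemma pow_no_eig {V : H →L[ℂ] H} (hV : IsCompactOperator V)
    (hne : ∀ μ : ℂ, μ ≠ 0 → ¬ Module.End.HasEigenvalue (V : H →ₗ[ℂ] H) μ) (k : ℕ) :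
    IsCompactOperator (V ^ (k + 1) : H →L[ℂ] H) ∧
    ∀ μ : ℂ, μ ≠ 0 → ¬ Module.End.HasEigenvalue ((V ^ (k + 1) : H →L[ℂ] H) : H →ₗ[ℂ] H) μ := by
  have hc : IsCompactOperator (V ^ (k + 1) : H →L[ℂ] H) := by
    rw [pow_succ]
    exact hV.clm_comp (V ^ k)
  refine ⟨hc, fun μ hμ h => ?_⟩
  rw [hc.hasEigenvalue_iff_mem_spectrum hμ, spectrum.map_pow_of_pos _ (Nat.succ_pos k)] at h
  obtain ⟨z, hz, rfl⟩ := h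
  have hz0 : z ≠ 0 := by rintro rfl; simp at hμ
  exact hne z hz0 ((hV.hasEigenvalue_iff_mem_spectrum hz0).mpr hz)

lemma compact_of_apx {K : H →L[ℂ] H} {d : ℕ → ℝ} (hK : Apx K d) (hd : Tendsto d atTop (𝓝 0)) :
    IsCompactOperator K := by
  choose G h1 h2 h3 using fun n : ℕ => hK n (1 / ((n : ℝ) + 1)) (by positivity)
  refine isCompactOperator_of_tendsto (F := G) (l := atTop) ?_ (Eventually.of_forall fun n => ?_)
  · rw [tendsto_iff_norm_sub_tendsto_zero]
    have h4 := hd.add tendsto_one_div_add_atTop_nhds_zero_nat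
    rw [add_zero] at h4
    refine squeeze_zero (fun n => norm_nonneg _) (fun n => ?_) h4
    rw [norm_sub_rev]
    exact h3 n
  · have := h1 n
    let R := LinearMap.range (G n : H →ₗ[ℂ] H)
    have : LocallyCompactSpace R := by
      have : ProperSpace R := FiniteDimensional.proper ℂ R
      infer_instance
    exact (isCompactOperator_of_locallyCompactSpace_rng R.subtypeL).comp_clm
      ((G n).codRestrict R fun x => ⟨x, rfl⟩)

/-- The ordered eigenbasis of `B`. -/
lemma ordered_basis {B : H →L[ℂ] H} (hc : IsCompactOperator B) (hB : B.IsPositive)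
    (hinj : Function.Injective B) {α a : ℝ} (ha : 0 < a)
    (hBα : Tendsto (fun n : ℕ => (n : ℝ) ^ α * sNum B n) atTop (𝓝 a)) :
    ∃ (b : HilbertBasis ℕ ℂ H) (l : ℕ → ℝ), (∀ j, 0 ≤ l j) ∧ Antitone l ∧
      (∀ j, B (b j) = (l j : ℂ) • b j) ∧ (∀ j, sNum B (j + 1) = l j) ∧
      Tendsto (fun j : ℕ => ((j : ℝ) + 1) ^ α * l j) atTop (𝓝 a) := by
  obtain ⟨ι, b, lam, hpos, hlam⟩ := eigenbasis hc hB hinj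
  have : Infinite ι := by
    by_contra hfin
    rw [not_infinite_iff_finite] at hfin
    have := Fintype.ofFinite ι
    have hfd : FiniteDimensional ℂ H := b.toOrthonormalBasis.toBasis.finiteDimensional_of_finite
    have h0 : ∀ᶠ n : ℕ in atTop, (n : ℝ) ^ α * sNum B n = 0 := by
      filter_upwards [eventually_gt_atTop (finrank ℂ (LinearMap.range (B : H →ₗ[ℂ] H)))] with n hn
      have h1 := sNum_le B B n (by rw [← Module.finrank_eq_rank]; exact_mod_cast hn)
      rw [sub_self, norm_zero] at h1
      rw [le_antisymm h1 (sNum_nonneg B n), mul_zero]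
    have := tendsto_nhds_unique hBα (tendsto_const_nhds.congr' (h0.mono fun n hn => hn.symm))
    exact ha.ne' this
  obtain ⟨e, he⟩ := enum_desc lam fun i => level_finite hc b.orthonormal hlam (lam i) (hpos i)
  have hv : Orthonormal ℂ (fun n => b (e n)) := b.orthonormal.comp e e.injective
  have hsp : ⊤ ≤ (Submodule.span ℂ (Set.range fun n => b (e n))).topologicalClosure := by
    have : (Set.range fun n => b (e n)) = Set.range b := e.surjective.range_comp b
    rw [this, b.dense_span]
  let b' := HilbertBasis.mk hv hsp
  have hb' : ∀ n, b' n = b (e n) := fun n => by simp [b']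
  have hBb : ∀ j, B (b' j) = (lam (e j) : ℂ) • b' j := fun j => by rw [hb', hlam]
  have hs := sNum_diag b' (l := fun n => lam (e n)) (fun j => (hpos _).le) he hBb
  refine ⟨b', fun n => lam (e n), fun j => (hpos _).le, he, hBb, hs, ?_⟩
  have := hBα.comp (tendsto_add_atTop_nat 1)
  refine this.congr fun n => ?_
  simp only [Function.comp]
  rw [hs n]
  push_cast
  rfl

theorem main_abs {B K : H →L[ℂ] H} (hc : IsCompactOperator B) (hB : B.IsPositive)
    (hinj : Function.Injective B) {α a q : ℝ} (hα0 : 0 < α) (hα2 : α < 2) (ha : 0 < a)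
    (hBα : Tendsto (fun n : ℕ => (n : ℝ) ^ α * sNum B n) atTop (𝓝 a))
    (hq0 : 0 < q) (hqα : q ≤ 1 / α) (hKq : Summable (fun n : ℕ => sNum K (n + 1) ^ q)) :
    ∃ μ : ℂ, μ ≠ 0 ∧ Module.End.HasEigenvalue ((B + K : H →L[ℂ] H) : H →ₗ[ℂ] H) μ := by
  by_contra hcon
  push Not at hcon
  obtain ⟨b, l, hl0, hla, hBb, hs, hlim⟩ := ordered_basis hc hB hinj ha hBα
  set d : ℕ → ℝ := fun n => sNum K (n + 1) with hd
  have hd0 : ∀ n, 0 ≤ d n := fun n => sNum_nonneg _ _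
  have hda : Antitone d := fun i j hij => sNum_anti K hij
  have hdα := decay_of_summable hda hd0 hq0 hα0 hqα hKq
  have hKd : Apx K d := apx_sNum K
  have hd1 : Tendsto d atTop (𝓝 0) := by
    refine squeeze_zero hd0 (fun n => ?_) hdα
    refine le_mul_of_one_le_left (hd0 n) (Real.one_le_rpow ?_ hα0.le)
    linarith [(Nat.cast_nonneg n : (0 : ℝ) ≤ n)]
  have hV : IsCompactOperator (B + K) := hc.add (compact_of_apx hKd hd1)
  have hBl : Apx B l := by
    have := apx_sNum B
    simpa only [hs] using this
  obtain ⟨A, hA0, hA⟩ := bdd_of_tendsto hlim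
  have hBbig : Big α B := ⟨l, hBl, A, hA⟩
  have hKsm : Sm α K := ⟨d, hKd, hdα⟩
  have hVbig : Big α (B + K) := hBbig.add hα0.le hKsm.big
  by_cases hα1 : α = 1
  · subst hα1
    obtain ⟨c, hcV, C, hC⟩ := hVbig
    simp only [Real.rpow_one] at hA hC hlim
    obtain ⟨μ, t1, t2, t3, t4, t5⟩ := trunc_data b hBb hV hcon hcV hKd
    have hq1 : q ≤ 1 := by simpa using hqα
    have hdsum : Summable d := by
      refine Summable.of_norm_bounded_eventually_nat hKq ?_
      filter_upwards [hd1.eventually_le_const zero_lt_one] with n hn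
      rw [Real.norm_of_nonneg (hd0 n)]
      calc d n = d n ^ (1 : ℝ) := (Real.rpow_one _).symm
        _ ≤ d n ^ q := Real.rpow_le_rpow_of_exponent_ge_of_imp (hd0 n) hn hq1 (by
            intro _ h; exact absurd h one_ne_zero)
    have hcsum : Summable fun j => c j ^ 2 := by
      have h1 : Summable fun n : ℕ => C ^ 2 * (1 / ((n : ℝ) + 1) ^ 2) := by
        refine Summable.mul_left _ ?_
        have := (summable_nat_add_iff 1).mpr (Real.summable_one_div_nat_pow.mpr one_lt_two)
        simpa using this
      refine Summable.of_nonneg_of_le (fun n => sq_nonneg _) (fun n => ?_) h1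
      have h2 : c n ≤ C / ((n : ℝ) + 1) := by
        rw [le_div_iff₀ (by positivity)]; linarith [hC n]
      have := pow_le_pow_left₀ (apx_nonneg hcV n) h2 2
      rw [div_pow] at this
      rwa [mul_one_div]
    have hsum := stepD (l := l) (c := c) (d := d) (μ := μ) ⟨t1, t2, t3, t4, t5⟩ hl0 (A + 1)
      (by linarith) (fun j => by
        rw [le_div_iff₀ (by positivity)]; linarith [hA j]) hd0 hdsum hcsum
    exact ha.ne' (tendsto_nhds_unique hlim (anti_summable hla hl0 hsum))
  · obtain ⟨k, hk1, hk2⟩ : ∃ k : ℕ, 1 < ((k : ℝ) + 1) * α ∧ ((k : ℝ) + 1) * α < 2 := by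
      have h1 : ((⌊1 / α⌋₊ : ℕ) : ℝ) ≤ 1 / α := Nat.floor_le (by positivity)
      have h2 := Nat.lt_floor_add_one (1 / α)
      rw [le_div_iff₀ hα0] at h1
      rw [div_lt_iff₀ hα0] at h2
      refine ⟨⌊1 / α⌋₊, h2, ?_⟩
      rcases lt_or_gt_of_ne hα1 with h | h
      · linarith
      · have : ⌊1 / α⌋₊ = 0 := by
          rw [Nat.floor_eq_zero, div_lt_one hα0]; exact h
        rw [this]; simpa using hα2
    have hVB : (B + K) - B = K := by abel
    obtain ⟨-, ⟨c, hcV, C, hC⟩, ⟨d', hd', hd'l⟩⟩ := pow_data hα0 hBbig hVbig (by rwa [hVB]) k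
    obtain ⟨hVk, hnek⟩ := pow_no_eig hV hcon k
    have hsplit : B ^ (k + 1) + ((B + K) ^ (k + 1) - B ^ (k + 1)) = (B + K) ^ (k + 1) := by abel
    have hBk : ∀ j, (B ^ (k + 1)) (b j) = ((l j ^ (k + 1) : ℝ) : ℂ) • b j := by
      intro j
      generalize k + 1 = n
      induction n with
      | zero => simp
      | succ n ih =>
        rw [pow_succ, ContinuousLinearMap.mul_apply, hBb, map_smul, ih, smul_smul, pow_succ]
        push_cast
        rw [mul_comm]
    obtain ⟨μ, t1, t2, t3, t4, t5⟩ := trunc_data b (K := (B + K) ^ (k + 1) - B ^ (k + 1))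
      (l := fun j => l j ^ (k + 1)) hBk (by rw [hsplit]; exact hVk) (by rw [hsplit]; exact hnek)
      (by rw [hsplit]; exact hcV) hd'
    set β := ((k : ℝ) + 1) * α with hβ
    have hc0 := apx_nonneg hcV
    have hcsum : Summable c := by
      have h1 : Summable fun n : ℕ => C * (1 / ((n : ℝ) + 1) ^ β) := by
        refine Summable.mul_left _ ?_
        have := (summable_nat_add_iff 1).mpr (Real.summable_one_div_nat_rpow.mpr hk1)
        simpa using this
      refine Summable.of_nonneg_of_le hc0 (fun n => ?_) h1
      rw [mul_one_div, le_div_iff₀ (by positivity)]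
      linarith [hC n]
    refine stepC (l := fun j => l j ^ (k + 1)) (c := c) (d := d') (μ := μ) ⟨t1, t2, t3, t4, t5⟩
      hc0 hcsum (apx_nonneg hd') (fun j => pow_nonneg (hl0 j) _) β (a ^ (k + 1)) hk1 hk2
      (by positivity) ?_ hd'l
    refine (hlim.pow (k + 1)).congr fun j => ?_
    rw [mul_pow, ← Real.rpow_natCast, ← Real.rpow_mul (by positivity), hβ]
    push_cast
    rw [mul_comm α]

end BK

/-- **Theorem 3.1.** Let `Ω ⊂ ℝ^m` be a bounded domain with infinitely smooth boundary,
let `B` be a non-negative injective compact operator on `L²(Ω)` inverting `-Δ` in the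
distributional sense, with `n ^ 2 * s n (B) → ∞` and `n ^ α * s n (B) → a` for some
`0 < α < 2`, `0 < a < ∞`, and let `K ∈ S_q` (`0 < q ≤ 1/α`) have range consisting of
harmonic functions.  Then `B + K` has a nonzero eigenvalue, i.e. the corresponding
well-defined restriction `L_K` of the maximal operator is not Volterra. -/
theorem statement4 {m : ℕ} (Ω : Set (EuclideanSpace ℝ (Fin m)))
    (hΩopen : IsOpen Ω) (hΩconn : IsConnected Ω) (hΩbdd : Bornology.IsBounded Ω)
    (hΩsmooth : HasSmoothBoundary Ω)
    (B K : Lp ℂ 2 (volume.restrict Ω) →L[ℂ] Lp ℂ 2 (volume.restrict Ω))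
    (hBpos : B.IsPositive) (hBinj : Function.Injective ⇑B)
    (hBcompact : IsCompactOperator (⇑B))
    (hBinv : ∀ f : Lp ℂ 2 (volume.restrict Ω), WeakNegLapEq Ω (⇑(B f)) (⇑f))
    (α a q : ℝ) (hα0 : 0 < α) (hα2 : α < 2) (ha0 : 0 < a)
    (hB2 : Tendsto (fun n : ℕ => (n : ℝ) ^ 2 * sNum B n) atTop atTop)
    (hBα : Tendsto (fun n : ℕ => (n : ℝ) ^ α * sNum B n) atTop (𝓝 a))
    (hq0 : 0 < q) (hqα : q ≤ 1 / α)
    (hKq : Summable (fun n : ℕ => sNum K (n + 1) ^ q))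
    (hKharm : ∀ f : Lp ℂ 2 (volume.restrict Ω), WeakHarmonicOn Ω (⇑(K f))) :
    ∃ μ : ℂ, μ ≠ 0 ∧
      Module.End.HasEigenvalue ((B + K : Lp ℂ 2 (volume.restrict Ω) →L[ℂ]
        Lp ℂ 2 (volume.restrict Ω)) : Lp ℂ 2 (volume.restrict Ω) →ₗ[ℂ]
        Lp ℂ 2 (volume.restrict Ω)) μ := by
  exact BK.main_abs hBcompact hBpos hBinj hα0 hα2 ha0 hBα hq0 hqα hKq
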